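/- Assume the family {P^u}_{u∈(a,b)} satisfies P1–P3 and S1–S2, and let the scales l_k, r_k, L_k and the notion of k-bad vertices be as in the renormalization scheme. For each u ∈ (a,b) there exist C = C(u) < ∞ and C′ = C′(u,l_0) < ∞ such that for all integers l_0, r_0 ≥ C, L_0 ≥ C′, and all k ≥ 0: P^u[0 is k-bad] ≤ 2·2^{−2^k}. -/

import Mathlib

open MeasureTheory Filter
open scoped ENNReal

namespace Perco

/-- A point of the lattice `ℤ^d`. -/
abbrev Pt (d : ℕ) := Fin d → ℤ

/-- A percolation configuration on `ℤ^d`. -/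
abbrev Config (d : ℕ) := Pt d → Bool

variable {d : ℕ}

/-- The `ℓ¹`-distance on `ℤ^d`. -/
def dist1 (x y : Pt d) : ℕ := ∑ i, (x i - y i).natAbs

/-- The `ℓ^∞`-distance on `ℤ^d`. -/
def distInf (x y : Pt d) : ℕ := Finset.univ.sup fun i => (x i - y i).natAbs

/-- The closed `ℓ^∞`-ball of radius `R` around `x`. -/
def ballZ (x : Pt d) (R : ℕ) : Set (Pt d) := {y | distInf x y ≤ R}

/-- Nearest-neighbour adjacency in `ℤ^d`. -/
def adj (x y : Pt d) : Prop := dist1 x y = 1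

/-- The occupied set of a configuration. -/
def SS (ω : Config d) : Set (Pt d) := {x | ω x = true}

/-- One step of a nearest-neighbour path staying inside `T`. -/
def stepRel (T : Set (Pt d)) (x y : Pt d) : Prop := adj x y ∧ x ∈ T ∧ y ∈ T

/-- `x` and `y` are connected by a nearest-neighbour path inside `T`. -/
def connIn (T : Set (Pt d)) (x y : Pt d) : Prop :=
  x ∈ T ∧ y ∈ T ∧ Relation.ReflTransGen (stepRel T) x y

/-- The connected component (cluster) of `x` in `T`. -/
def cluster (T : Set (Pt d)) (x : Pt d) : Set (Pt d) := {y | connIn T x y}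

/-- `S_r`: vertices of `S(ω)` in connected components of `ℓ¹`-diameter at least `r`. -/
def Sr (ω : Config d) (r : ℝ) : Set (Pt d) :=
  {x | x ∈ SS ω ∧ ∃ y ∈ cluster (SS ω) x, ∃ z ∈ cluster (SS ω) x, r ≤ (dist1 y z : ℝ)}

/-- `S_∞`: vertices of `S(ω)` in infinite connected components. -/
def Sinf (ω : Config d) : Set (Pt d) := {x | x ∈ SS ω ∧ (cluster (SS ω) x).Infinite}

/-- The shift of a configuration by `x`. -/
def shift (x : Pt d) (ω : Config d) : Config d := fun y => ω (x + y)

/-- An increasing event. -/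
def IncreasingEvent (G : Set (Config d)) : Prop :=
  ∀ ω ω' : Config d, (∀ x, ω x = true → ω' x = true) → ω ∈ G → ω' ∈ G

/-- A decreasing event. -/
def DecreasingEvent (G : Set (Config d)) : Prop :=
  ∀ ω ω' : Config d, (∀ x, ω' x = true → ω x = true) → ω ∈ G → ω' ∈ G

/-- The event `G` depends only on the coordinates in `B`. -/
def DependsOn (G : Set (Config d)) (B : Set (Pt d)) : Prop :=
  ∀ ω ω' : Config d, (∀ x ∈ B, ω x = ω' x) → (ω ∈ G ↔ ω' ∈ G)

/-- The edge boundary of `A` in `Sset`: (directed representatives of) edges of `ℤ^d`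
with one endpoint in `A` and the other in `Sset \ A`. -/
def edgeBd (Sset A : Set (Pt d)) : Set (Pt d × Pt d) :=
  {p | adj p.1 p.2 ∧ p.1 ∈ A ∧ p.2 ∈ Sset \ A}

/-- The density `η(u) = P[0 ∈ S_∞]` of the infinite cluster. -/
noncomputable def eta (d : ℕ) (P : Measure (Config d)) : ℝ :=
  (P {ω | (0 : Pt d) ∈ Sinf ω}).toReal

/-- The first local-uniqueness event of axiom S1. -/
def locUniq1 (d : ℕ) (R : ℕ) : Set (Config d) :=
  {ω | (Sr ω R ∩ ballZ (0 : Pt d) R).Nonempty}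

/-- The second local-uniqueness event of axiom S1. -/
def locUniq2 (d : ℕ) (R : ℕ) : Set (Config d) :=
  {ω | ∀ x ∈ Sr ω ((R : ℝ)/10) ∩ ballZ (0 : Pt d) R,
       ∀ y ∈ Sr ω ((R : ℝ)/10) ∩ ballZ (0 : Pt d) R,
       connIn (SS ω ∩ ballZ (0 : Pt d) (2*R)) x y}

/-- The axioms **P1**–**P3** and **S1**–**S2** of Drewitz–Ráth–Sapozhnikov for a
one-parameter family of probability measures on `{0,1}^{ℤ^d}`. -/
structure Axioms (d : ℕ) (a b : ℝ) (P : ℝ → Measure (Config d)) where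
  /-- decoupling exponent -/
  εP : ℝ
  /-- sprinkling exponent -/
  χP : ℝ
  RP : ℕ
  LP : ℕ
  fP : ℕ → ℝ
  fS : ℝ → ℕ → ℝ
  ΔS : ℝ → ℝ
  RS : ℝ → ℕ
  prob : ∀ u ∈ Set.Ioo a b, IsProbabilityMeasure (P u)
  /-- P1: every lattice shift is measure preserving and ergodic. -/
  ergodic : ∀ u ∈ Set.Ioo a b, ∀ x : Pt d, x ≠ 0 → Ergodic (shift x) (P u)
  /-- P2: monotonicity. -/
  mono : ∀ u ∈ Set.Ioo a b, ∀ u' ∈ Set.Ioo a b, u ≤ u' →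
    ∀ G : Set (Config d), MeasurableSet G → IncreasingEvent G → P u G ≤ P u' G
  εP_pos : 0 < εP
  χP_pos : 0 < χP
  fP_lb : ∀ L : ℕ, LP ≤ L → Real.exp ((Real.log L) ^ εP) ≤ fP L
  /-- P3, decoupling for decreasing events. -/
  decoupleDec : ∀ (R L : ℕ), RP ≤ R → 1 ≤ L → ∀ x₁ x₂ : Pt d, R * L ≤ distInf x₁ x₂ →
    ∀ u uh : ℝ, uh ∈ Set.Ioo a b → u ∈ Set.Ioo a b → uh < u →
    (1 + (R : ℝ) ^ (-χP)) * uh ≤ u →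
    ∀ A₁ A₂ : Set (Config d), MeasurableSet A₁ → MeasurableSet A₂ →
      DecreasingEvent A₁ → DecreasingEvent A₂ →
      DependsOn A₁ (ballZ x₁ (10*L)) → DependsOn A₂ (ballZ x₂ (10*L)) →
      (P u (A₁ ∩ A₂)).toReal ≤ (P uh A₁).toReal * (P uh A₂).toReal + Real.exp (-(fP L))
  /-- P3, decoupling for increasing events. -/
  decoupleInc : ∀ (R L : ℕ), RP ≤ R → 1 ≤ L → ∀ x₁ x₂ : Pt d, R * L ≤ distInf x₁ x₂ →
    ∀ u uh : ℝ, uh ∈ Set.Ioo a b → u ∈ Set.Ioo a b → uh < u →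
    (1 + (R : ℝ) ^ (-χP)) * uh ≤ u →
    ∀ B₁ B₂ : Set (Config d), MeasurableSet B₁ → MeasurableSet B₂ →
      IncreasingEvent B₁ → IncreasingEvent B₂ →
      DependsOn B₁ (ballZ x₁ (10*L)) → DependsOn B₂ (ballZ x₂ (10*L)) →
      (P uh (B₁ ∩ B₂)).toReal ≤ (P u B₁).toReal * (P u B₂).toReal + Real.exp (-(fP L))
  ΔS_pos : ∀ u ∈ Set.Ioo a b, 0 < ΔS u
  fS_lb : ∀ u ∈ Set.Ioo a b, ∀ R : ℕ, RS u ≤ R → (Real.log R) ^ (1 + ΔS u) ≤ fS u R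
  /-- S1, first part. -/
  S1a : ∀ u ∈ Set.Ioo a b, ∀ R : ℕ, 1 ≤ R →
    1 - Real.exp (-(fS u R)) ≤ (P u (locUniq1 d R)).toReal
  /-- S1, second part. -/
  S1b : ∀ u ∈ Set.Ioo a b, ∀ R : ℕ, 1 ≤ R →
    1 - Real.exp (-(fS u R)) ≤ (P u (locUniq2 d R)).toReal
  /-- S2: positivity of the density of the infinite cluster. -/
  S2pos : ∀ u ∈ Set.Ioo a b, 0 < eta d (P u)
  /-- S2: continuity of the density of the infinite cluster. -/
  S2cont : ContinuousOn (fun u => eta d (P u)) (Set.Ioo a b)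


/-! ### Renormalization scales and good/bad boxes -/

/-- The scales `l_k = l_0·4^{k^{θ_sc}}`. -/
def lSc (l0 θsc k : ℕ) : ℕ := l0 * 4 ^ (k ^ θsc)

/-- The scales `r_k = r_0·2^{k^{θ_sc}}`. -/
def rSc (r0 θsc k : ℕ) : ℕ := r0 * 2 ^ (k ^ θsc)

/-- The scales `L_0 = L_0`, `L_{k+1} = l_k·L_k`. -/
def LSc (l0 L0 θsc : ℕ) : ℕ → ℕ
  | 0 => L0
  | k+1 => lSc l0 θsc k * LSc l0 L0 θsc k

/-- The renormalized lattice `G = L·ℤ^d`. -/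
def lattice (d L : ℕ) : Set (Pt d) := {x | ∀ i, (L : ℤ) ∣ x i}

/-- The box `x + [0,n)^d`. -/
def box (x : Pt d) (n : ℕ) : Set (Pt d) := {y | ∀ i, x i ≤ y i ∧ y i < x i + n}

/-- The box `x + [lo,hi)^d`. -/
def boxI (x : Pt d) (lo hi : ℤ) : Set (Pt d) := {y | ∀ i, x i + lo ≤ y i ∧ y i < x i + hi}

/-- The corner `x + e·L_0` of the sub-box indexed by `e ∈ {0,1}^d`. -/
def subCorner (x : Pt d) (L0 : ℕ) (e : Fin d → Bool) : Pt d :=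
  fun i => x i + (if e i then (L0 : ℤ) else 0)

/-- `C` is a connected component of `S_{L0} ∩ B` of cardinality at least `(3/4)·η·L_0^d`. -/
def bigCompIn (ω : Config d) (η : ℝ) (L0 : ℕ) (B : Set (Pt d)) (C : Set (Pt d)) : Prop :=
  (∃ w ∈ Sr ω (L0 : ℝ) ∩ B, C = cluster (Sr ω (L0 : ℝ) ∩ B) w) ∧
  (3/4 : ℝ) * η * (L0 : ℝ) ^ d ≤ C.ncard

/-- The event `A^u_x`: each of the `2^d` sub-boxes of side `L_0` of `x + [0,2L_0)^d` contains a
connected component of `S_{L_0}` with at least `(3/4)·η·L_0^d` vertices, and all these components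
are connected in `S ∩ (x+[0,2L_0)^d)`. -/
def eventA (d : ℕ) (η : ℝ) (L0 : ℕ) (x : Pt d) : Set (Config d) :=
  {ω | (∀ e : Fin d → Bool, ∃ C, bigCompIn ω η L0 (box (subCorner x L0 e) L0) C) ∧
       (∀ e e' : Fin d → Bool, ∀ C C' : Set (Pt d), ∀ y z : Pt d,
          bigCompIn ω η L0 (box (subCorner x L0 e) L0) C →
          bigCompIn ω η L0 (box (subCorner x L0 e') L0) C' →
          y ∈ C → z ∈ C' → connIn (SS ω ∩ box x (2*L0)) y z)}

/-- The event `B^u_x`: each of the `2^d` sub-boxes of side `L_0` of `x + [0,2L_0)^d` contains at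
most `(5/4)·η·L_0^d` vertices of `S_{L_0}`. -/
def eventB (d : ℕ) (η : ℝ) (L0 : ℕ) (x : Pt d) : Set (Config d) :=
  {ω | ∀ e : Fin d → Bool,
    ((Sr ω (L0 : ℝ) ∩ box (subCorner x L0 e) L0).ncard : ℝ) ≤ (5/4 : ℝ) * η * (L0 : ℝ) ^ d}

/-- The recursive cascading of a family of "bad" seed events along the renormalization scheme. -/
def cascade (d : ℕ) (r0 l0 L0 θsc : ℕ) (seed : Pt d → Set (Config d)) :
    ℕ → Pt d → Set (Config d)
  | 0, x => seed x
  | k+1, x => {ω | ∃ x₁ x₂ : Pt d,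
      x₁ ∈ lattice d (LSc l0 L0 θsc k) ∩ box x (LSc l0 L0 θsc (k+1)) ∧
      x₂ ∈ lattice d (LSc l0 L0 θsc k) ∩ box x (LSc l0 L0 θsc (k+1)) ∧
      rSc r0 θsc k * LSc l0 L0 θsc k ≤ distInf x₁ x₂ ∧
      ω ∈ cascade d r0 l0 L0 θsc seed k x₁ ∧ ω ∈ cascade d r0 l0 L0 θsc seed k x₂}

/-- The event `Ā^u_{x,k}`. -/
def Abar (d : ℕ) (η : ℝ) (r0 l0 L0 θsc : ℕ) : ℕ → Pt d → Set (Config d) :=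
  cascade d r0 l0 L0 θsc (fun x => (eventA d η L0 x)ᶜ)

/-- The event `B̄^u_{x,k}`. -/
def Bbar (d : ℕ) (η : ℝ) (r0 l0 L0 θsc : ℕ) : ℕ → Pt d → Set (Config d) :=
  cascade d r0 l0 L0 θsc (fun x => (eventB d η L0 x)ᶜ)

/-- The event that `x ∈ G_k` is `k`-bad. -/
def kBad (d : ℕ) (η : ℝ) (r0 l0 L0 θsc k : ℕ) (x : Pt d) : Set (Config d) :=
  Abar d η r0 l0 L0 θsc k x ∪ Bbar d η r0 l0 L0 θsc k x

theorem distInf_le_iff (x y : Pt d) (n : ℕ) : distInf x y ≤ n ↔ ∀ i, (x i - y i).natAbs ≤ n := by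
  simp [distInf, Finset.sup_le_iff]

theorem natAbs_le_distInf (x y : Pt d) (i : Fin d) : (x i - y i).natAbs ≤ distInf x y :=
  (distInf_le_iff x y _).1 le_rfl i

theorem distInf_le_dist1 (x y : Pt d) : distInf x y ≤ dist1 x y := by
  rw [distInf_le_iff]
  intro i
  exact Finset.single_le_sum (f := fun i => (x i - y i).natAbs) (fun _ _ => Nat.zero_le _)
    (Finset.mem_univ i)

theorem mem_ballZ_iff (x y : Pt d) (n : ℕ) : y ∈ ballZ x n ↔ ∀ i, (x i - y i).natAbs ≤ n :=
  distInf_le_iff x y n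

theorem ballZ_finite (x : Pt d) (n : ℕ) : (ballZ x n).Finite := by
  apply (Set.finite_Icc (fun i => x i - (n : ℤ)) (fun i => x i + (n : ℤ))).subset
  intro y hy
  rw [mem_ballZ_iff] at hy
  constructor <;> intro i <;> have := hy i <;> simp only <;> omega

theorem box_finite (x : Pt d) (n : ℕ) : (box x n).Finite := by
  apply (Set.finite_Icc x (fun i => x i + (n : ℤ))).subset
  intro y hy
  constructor <;> intro i <;> have := hy i <;> simp only <;> omega

theorem adj_symm {x y : Pt d} (h : adj x y) : adj y x := by
  unfold adj dist1 at *
  rw [← h]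
  exact Finset.sum_congr rfl fun i _ => by omega

theorem adj_natAbs {x y : Pt d} (h : adj x y) (i : Fin d) : (x i - y i).natAbs ≤ 1 := by
  have h1 := natAbs_le_distInf x y i
  have h2 := distInf_le_dist1 x y
  unfold adj at h
  omega

theorem connIn_refl {T : Set (Pt d)} {x : Pt d} (h : x ∈ T) : connIn T x x :=
  ⟨h, h, Relation.ReflTransGen.refl⟩

theorem stepRel_symm {T : Set (Pt d)} {x y : Pt d} (h : stepRel T x y) : stepRel T y x :=
  ⟨adj_symm h.1, h.2.2, h.2.1⟩

theorem connIn_symm {T : Set (Pt d)} {x y : Pt d} (h : connIn T x y) : connIn T y x := by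
  refine ⟨h.2.1, h.1, ?_⟩
  have h2 := h.2.2
  clear h
  induction h2 with
  | refl => exact Relation.ReflTransGen.refl
  | tail _ hbc ih => exact ih.head (stepRel_symm hbc)

theorem connIn_trans {T : Set (Pt d)} {x y z : Pt d} (h : connIn T x y) (h' : connIn T y z) :
    connIn T x z := ⟨h.1, h'.2.1, h.2.2.trans h'.2.2⟩

theorem connIn_mono {T T' : Set (Pt d)} (hT : T ⊆ T') {x y : Pt d} (h : connIn T x y) :
    connIn T' x y :=
  ⟨hT h.1, hT h.2.1, Relation.ReflTransGen.mono (r := stepRel T) (p := stepRel T')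
    (fun _ _ s => ⟨s.1, hT s.2.1, hT s.2.2⟩) _ _ h.2.2⟩

/-- Induction principle for paths. -/
theorem connIn_induct {T : Set (Pt d)} {x y : Pt d} (h : connIn T x y) (Q : Pt d → Prop)
    (h0 : Q x) (hs : ∀ b c, connIn T x b → Q b → adj b c → c ∈ T → Q c) : Q y := by
  obtain ⟨hx, hy, hr⟩ := h
  have : y ∈ T ∧ Relation.ReflTransGen (stepRel T) x y ∧ Q y := by
    clear hy
    induction hr with
    | refl => exact ⟨hx, Relation.ReflTransGen.refl, h0⟩
    | tail hab hbc ih =>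
      exact ⟨hbc.2.2, ih.2.1.tail hbc, hs _ _ ⟨hx, ih.1, ih.2.1⟩ ih.2.2 hbc.1 hbc.2.2⟩
  exact this.2.2

theorem connIn_step {T : Set (Pt d)} {x b c : Pt d} (h : connIn T x b) (ha : adj b c) (hc : c ∈ T) :
    connIn T x c := ⟨h.1, hc, h.2.2.tail ⟨ha, h.2.1, hc⟩⟩

theorem adj_add_left (z x y : Pt d) : adj (z + x) (z + y) ↔ adj x y := by
  simp [adj, dist1]

theorem connIn_shift {T : Set (Pt d)} (z x y : Pt d) (h : connIn {w | z + w ∈ T} x y) :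
    connIn T (z + x) (z + y) := by
  refine connIn_induct h (fun y => connIn T (z + x) (z + y)) (connIn_refl h.1) ?_
  intro b c _ hb ha hc
  exact connIn_step hb ((adj_add_left z b c).2 ha) hc

theorem connIn_shift' {T : Set (Pt d)} (z x y : Pt d) (h : connIn T (z + x) (z + y)) :
    connIn {w | z + w ∈ T} x y := by
  have := connIn_shift (T := {w | z + w ∈ T}) (-z) (z + x) (z + y) (by simpa using h)
  simpa using this

theorem connIn_shift_iff {T : Set (Pt d)} (z x y : Pt d) :
    connIn {w | z + w ∈ T} x y ↔ connIn T (z + x) (z + y) :=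
  ⟨connIn_shift z x y, connIn_shift' z x y⟩

theorem SS_shift (z : Pt d) (ω : Config d) : SS (shift z ω) = {w | z + w ∈ SS ω} := rfl

theorem dist1_add_left (z x y : Pt d) : dist1 (z + x) (z + y) = dist1 x y := by
  simp [dist1]

theorem mem_Sr_shift (z x : Pt d) (ω : Config d) (r : ℝ) :
    x ∈ Sr (shift z ω) r ↔ z + x ∈ Sr ω r := by
  unfold Sr cluster
  simp only [Set.mem_ofPred_eq, SS_shift, connIn_shift_iff]
  constructor
  · rintro ⟨h, y, hy, w, hw, hr⟩
    exact ⟨h, z + y, hy, z + w, hw, by rwa [dist1_add_left]⟩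
  · rintro ⟨h, y, hy, w, hw, hr⟩
    refine ⟨h, -z + y, by simpa using hy, -z + w, by simpa using hw, by rwa [dist1_add_left]⟩

theorem cluster_shift (z x : Pt d) (ω : Config d) :
    cluster (SS (shift z ω)) x = (fun y => z + y) ⁻¹' cluster (SS ω) (z + x) := by
  ext y
  simp only [cluster, SS_shift, connIn_shift_iff, Set.mem_preimage, Set.mem_ofPred_eq]

theorem mem_Sinf_shift (z x : Pt d) (ω : Config d) :
    x ∈ Sinf (shift z ω) ↔ z + x ∈ Sinf ω := by
  unfold Sinf
  simp only [Set.mem_ofPred_eq, cluster_shift]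
  have : ((fun y => z + y) ⁻¹' cluster (SS ω) (z + x)).Infinite ↔
      (cluster (SS ω) (z + x)).Infinite := by
    rw [not_iff_not.symm, Set.not_infinite, Set.not_infinite]
    constructor
    · intro hf
      refine (hf.image (fun y => z + y)).subset ?_
      intro y hy
      exact ⟨-z + y, by simpa using hy, by simp⟩
    · intro hf
      exact hf.preimage (fun a _ b _ h => by simpa using h)
  rw [this]
  rfl

/-- The cluster of a vertex in `S_r`. -/
theorem Sr_of_conn {ω : Config d} {r : ℝ} {x y : Pt d} (hx : x ∈ Sr ω r) (h : connIn (SS ω) x y) :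
    y ∈ Sr ω r := by
  obtain ⟨h0, p, hp, q, hq, hr⟩ := hx
  exact ⟨h.2.1, p, connIn_trans (connIn_symm h) hp, q, connIn_trans (connIn_symm h) hq, hr⟩

theorem connIn_Sr {ω : Config d} {r : ℝ} {B : Set (Pt d)} {x y : Pt d} (hx : x ∈ Sr ω r)
    (h : connIn (SS ω ∩ B) x y) : connIn (Sr ω r ∩ B) x y := by
  refine connIn_induct h (fun y => connIn (Sr ω r ∩ B) x y) (connIn_refl ⟨hx, h.1.2⟩) ?_
  intro b c hb hb' ha hc
  exact connIn_step hb' ha ⟨Sr_of_conn hx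
    (connIn_mono Set.inter_subset_left (connIn_step hb ha hc)), hc.2⟩

theorem Sr_subset_SS (ω : Config d) (r : ℝ) : Sr ω r ⊆ SS ω := fun _ h => h.1

theorem Sr_anti (ω : Config d) {r r' : ℝ} (h : r ≤ r') : Sr ω r' ⊆ Sr ω r := by
  rintro x ⟨h0, p, hp, q, hq, hr⟩
  exact ⟨h0, p, hp, q, hq, h.trans hr⟩

theorem Sinf_subset_Sr (ω : Config d) (r : ℝ) : Sinf ω ⊆ Sr ω r := by
  rintro x ⟨h0, hinf⟩
  obtain ⟨n, hn⟩ := exists_nat_ge r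
  obtain ⟨y, hy, hy'⟩ := hinf.exists_notMem_finite (ballZ_finite x n)
  refine ⟨h0, x, connIn_refl h0, y, hy, hn.trans ?_⟩
  have : n < distInf x y := not_le.1 hy'
  exact_mod_cast this.le.trans (distInf_le_dist1 x y)

theorem mem_Sinf_of_forall (ω : Config d) (x : Pt d) (h : ∀ n : ℕ, x ∈ Sr ω n) : x ∈ Sinf ω := by
  refine ⟨(h 0).1, fun hf => ?_⟩
  obtain ⟨M, hM⟩ : ∃ M : ℕ, ∀ y ∈ cluster (SS ω) x, ∀ z ∈ cluster (SS ω) x, dist1 y z ≤ M := by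
    have := ((hf.prod hf).image (fun p : Pt d × Pt d => dist1 p.1 p.2)).bddAbove
    obtain ⟨M, hM⟩ := this
    exact ⟨M, fun y hy z hz => hM ⟨(y, z), ⟨hy, hz⟩, rfl⟩⟩
  obtain ⟨_, p, hp, q, hq, hr⟩ := h (M + 1)
  have h1 := hM p hp q hq
  have h2 : M + 1 ≤ dist1 p q := by exact_mod_cast hr
  omega

theorem SS_mono {ω ω' : Config d} (h : ∀ x, ω x = true → ω' x = true) : SS ω ⊆ SS ω' :=
  fun x hx => h x hx

theorem Sr_mono {ω ω' : Config d} (h : ∀ x, ω x = true → ω' x = true) (r : ℝ) :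
    Sr ω r ⊆ Sr ω' r := by
  rintro x ⟨h0, p, hp, q, hq, hr⟩
  exact ⟨h x h0, p, connIn_mono (SS_mono h) hp, q, connIn_mono (SS_mono h) hq, hr⟩

/-- Locality of `S_n`. -/
theorem mem_Sr_iff_loc (ω : Config d) (n : ℕ) (x : Pt d) : x ∈ Sr ω (n : ℝ) ↔
    x ∈ SS ω ∧ ∃ p, connIn (SS ω ∩ ballZ x n) x p ∧ ∃ q, connIn (SS ω ∩ ballZ x n) x q ∧
      n ≤ dist1 p q := by
  have hxx : x ∈ ballZ x n := by simp [mem_ballZ_iff]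
  constructor
  · rintro ⟨h0, p, hp, q, hq, hr⟩
    have hr' : n ≤ dist1 p q := by exact_mod_cast hr
    have key : ∀ z, connIn (SS ω) x z → connIn (SS ω ∩ ballZ x n) x z ∨
        ∃ w, connIn (SS ω ∩ ballZ x n) x w ∧ n ≤ dist1 x w := by
      intro z hz
      refine connIn_induct hz (fun z => connIn (SS ω ∩ ballZ x n) x z ∨
        ∃ w, connIn (SS ω ∩ ballZ x n) x w ∧ n ≤ dist1 x w) (Or.inl (connIn_refl ⟨h0, hxx⟩)) ?_
      intro b c hb ih ha hc
      rcases ih with ih | ih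
      · by_cases hcb : c ∈ ballZ x n
        · exact Or.inl (connIn_step ih ha ⟨hc, hcb⟩)
        · refine Or.inr ⟨b, ih, le_trans ?_ (distInf_le_dist1 x b)⟩
          rw [mem_ballZ_iff] at hcb
          push Not at hcb
          obtain ⟨i, hi⟩ := hcb
          have h1 := adj_natAbs ha i
          have h2 := natAbs_le_distInf x b i
          omega
      · exact Or.inr ih
    refine ⟨h0, ?_⟩
    rcases key p hp with h1 | ⟨w, hw, hw'⟩
    · rcases key q hq with h2 | ⟨w, hw, hw'⟩
      · exact ⟨p, h1, q, h2, hr'⟩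
      · exact ⟨x, connIn_refl ⟨h0, hxx⟩, w, hw, hw'⟩
    · exact ⟨x, connIn_refl ⟨h0, hxx⟩, w, hw, hw'⟩
  · rintro ⟨h0, p, hp, q, hq, hr⟩
    exact ⟨h0, p, connIn_mono Set.inter_subset_left hp, q, connIn_mono Set.inter_subset_left hq,
      by exact_mod_cast hr⟩

theorem SS_inter_congr {ω ω' : Config d} {B : Set (Pt d)} (h : ∀ x ∈ B, ω x = ω' x) :
    SS ω ∩ B = SS ω' ∩ B := by
  ext x
  simp only [SS, Set.mem_inter_iff, Set.mem_ofPred_eq]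
  constructor <;> rintro ⟨h1, h2⟩
  · exact ⟨by rw [← h x h2]; exact h1, h2⟩
  · exact ⟨by rw [h x h2]; exact h1, h2⟩

theorem Sr_inter_congr {ω ω' : Config d} {B B' : Set (Pt d)} (n : ℕ)
    (hB : ∀ x ∈ B, ballZ x n ⊆ B') (h : ∀ x ∈ B', ω x = ω' x) :
    Sr ω (n : ℝ) ∩ B = Sr ω' (n : ℝ) ∩ B := by
  ext x
  simp only [Set.mem_inter_iff, and_congr_left_iff]
  intro hx
  rw [mem_Sr_iff_loc, mem_Sr_iff_loc, SS_inter_congr fun y hy => h y (hB x hx hy)]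
  have hxx : x ∈ B' := hB x hx (by simp [mem_ballZ_iff])
  have : x ∈ SS ω ↔ x ∈ SS ω' := by simp [SS, h x hxx]
  rw [this]

/-! Measurability -/

theorem measurableSet_of_dependsOn {G : Set (Config d)} {B : Set (Pt d)} (hB : B.Finite)
    (h : DependsOn G B) : MeasurableSet G := by
  have : Finite B := hB
  have hm : Measurable (fun (ω : Config d) (x : B) => ω x.1) :=
    measurable_pi_lambda _ fun x => measurable_pi_apply _
  have : G = (fun (ω : Config d) (x : B) => ω x.1) ⁻¹'
      ((fun (ω : Config d) (x : B) => ω x.1) '' G) := by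
    ext ω
    constructor
    · intro hω; exact ⟨ω, hω, rfl⟩
    · rintro ⟨ω', hω', he⟩
      exact (h ω' ω fun x hx => congrFun he ⟨x, hx⟩).1 hω'
  rw [this]
  exact hm (Set.toFinite _).measurableSet

theorem measurableSet_SS (x : Pt d) : MeasurableSet {ω : Config d | x ∈ SS ω} := by
  have h : MeasurableSet ((fun ω : Config d => ω x) ⁻¹' {true}) :=
    (measurable_pi_apply x) (measurableSet_singleton true)
  exact h

/-- `n`-step reachability. -/
def reachN (T : Set (Pt d)) (x : Pt d) : ℕ → Pt d → Prop
  | 0, y => x = y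
  | n+1, y => ∃ z, reachN T x n z ∧ stepRel T z y

theorem reach_iff (T : Set (Pt d)) (x y : Pt d) :
    Relation.ReflTransGen (stepRel T) x y ↔ ∃ n, reachN T x n y := by
  constructor
  · intro h
    induction h with
    | refl => exact ⟨0, rfl⟩
    | tail _ hbc ih =>
      obtain ⟨n, hn⟩ := ih
      exact ⟨n + 1, _, hn, hbc⟩
  · rintro ⟨n, hn⟩
    induction n generalizing y with
    | zero => cases hn; exact Relation.ReflTransGen.refl
    | succ n ih =>
      obtain ⟨z, hz, hs⟩ := hn
      exact (ih z hz).tail hs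

theorem measurableSet_connIn (B : Set (Pt d)) (x y : Pt d) :
    MeasurableSet {ω : Config d | connIn (SS ω ∩ B) x y} := by
  have hT : ∀ z, MeasurableSet {ω : Config d | z ∈ SS ω ∩ B} := fun z =>
    (measurableSet_SS z).inter (MeasurableSet.const (z ∈ B))
  have hn : ∀ n z, MeasurableSet {ω : Config d | reachN (SS ω ∩ B) x n z} := by
    intro n
    induction n with
    | zero => intro z; exact MeasurableSet.const _
    | succ n ih =>
      intro z
      simp only [reachN, stepRel]
      refine MeasurableSet.iUnion (f := fun (w : Pt d) => {ω : Config d | reachN (SS ω ∩ B) x n w ∧ adj w z ∧ w ∈ SS ω ∩ B ∧ z ∈ SS ω ∩ B}) ?_ |> fun h => by simpa [Set.ofPred_exists] using h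
      intro w
      exact (ih w).inter ((MeasurableSet.const _).inter ((hT w).inter (hT z)))
  simp only [connIn, reach_iff]
  refine (hT x).inter ((hT y).inter ?_)
  have h1 := MeasurableSet.iUnion (fun n => hn n y)
  rw [← Set.ofPred_exists] at h1
  exact h1

theorem measurableSet_connIn_SS (x y : Pt d) :
    MeasurableSet {ω : Config d | connIn (SS ω) x y} := by
  simpa using measurableSet_connIn Set.univ x y

theorem measurableSet_Sr (x : Pt d) (r : ℝ) : MeasurableSet {ω : Config d | x ∈ Sr ω r} := by
  have : {ω : Config d | x ∈ Sr ω r} = {ω | x ∈ SS ω} ∩ ⋃ y, ⋃ z, ({ω | connIn (SS ω) x y} ∩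
      ({ω | connIn (SS ω) x z} ∩ {_ω | r ≤ (dist1 y z : ℝ)})) := by
    ext ω
    simp only [Sr, cluster, Set.mem_ofPred_eq, Set.mem_inter_iff, Set.mem_iUnion]
    constructor
    · rintro ⟨h, y, hy, z, hz, hr⟩
      exact ⟨h, y, z, hy, hz, hr⟩
    · rintro ⟨h, y, z, hy, hz, hr⟩
      exact ⟨h, y, hy, z, hz, hr⟩
  rw [this]
  refine (measurableSet_SS x).inter (.iUnion fun y => .iUnion fun z => ?_)
  exact (measurableSet_connIn_SS x y).inter ((measurableSet_connIn_SS x z).inter (.const _))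

theorem Sinf_eq (x : Pt d) : {ω : Config d | x ∈ Sinf ω} = ⋂ n : ℕ, {ω | x ∈ Sr ω (n : ℝ)} := by
  ext ω
  simp only [Set.mem_ofPred_eq, Set.mem_iInter]
  exact ⟨fun h n => Sinf_subset_Sr ω _ h, mem_Sinf_of_forall ω x⟩

theorem measurableSet_Sinf (x : Pt d) : MeasurableSet {ω : Config d | x ∈ Sinf ω} := by
  rw [Sinf_eq]
  exact .iInter fun n => measurableSet_Sr x _

theorem measurableSet_locUniq1 (R : ℕ) : MeasurableSet (locUniq1 d R) := by
  have : locUniq1 d R = ⋃ x, ({ω : Config d | x ∈ Sr ω R} ∩ {_ω | x ∈ ballZ (0 : Pt d) R}) := by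
    ext ω
    simp [locUniq1, Set.Nonempty]
  rw [this]
  exact .iUnion fun x => (measurableSet_Sr x _).inter (.const _)

theorem measurableSet_locUniq2 (R : ℕ) : MeasurableSet (locUniq2 d R) := by
  have : locUniq2 d R = ⋂ x, ⋂ y, ({ω : Config d | x ∈ Sr ω ((R : ℝ)/10)}ᶜ ∪
      {_ω | x ∉ ballZ (0 : Pt d) R} ∪ ({ω : Config d | y ∈ Sr ω ((R : ℝ)/10)}ᶜ ∪
      {_ω | y ∉ ballZ (0 : Pt d) R}) ∪ {ω | connIn (SS ω ∩ ballZ (0 : Pt d) (2*R)) x y}) := by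
    ext ω
    simp only [locUniq2, Set.mem_inter_iff, Set.mem_ofPred_eq, Set.mem_iInter, Set.mem_union,
      Set.mem_compl_iff]
    constructor
    · intro h x y
      have := h x
      have := h x
      tauto
    · intro h x hx y hy
      have := h x y
      tauto
  rw [this]
  refine .iInter fun x => .iInter fun y => ?_
  exact ((((measurableSet_Sr x _).compl).union (.const _)).union
    (((measurableSet_Sr y _).compl).union (.const _))).union (measurableSet_connIn _ _ _)

theorem integral_abs_le_Lp_norm {α : Type*} [MeasurableSpace α] (μ : Measure α)
    [IsProbabilityMeasure μ] (g : Lp ℝ 2 μ) : ∫ ω, |g ω| ∂μ ≤ ‖g‖ := by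
  have h1 : ∫ ω, |g ω| ∂μ = (eLpNorm g 1 μ).toReal := by
    rw [eLpNorm_one_eq_lintegral_enorm, ← integral_norm_eq_lintegral_enorm (Lp.aestronglyMeasurable g)]
    rfl
  rw [h1, Lp.norm_def]
  exact ENNReal.toReal_mono (Lp.eLpNorm_ne_top g)
    (eLpNorm_le_eLpNorm_of_exponent_le (by norm_num) (Lp.aestronglyMeasurable g))

theorem hilbert_ergodic {E : Type*} [NormedAddCommGroup E] [InnerProductSpace ℝ E] [CompleteSpace E]
    (U : E →L[ℝ] E) (hU : ‖U‖ ≤ 1) (g : E) :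
    ∃ p : E, U p = p ∧ Tendsto (birkhoffAverage ℝ U id · g) atTop (nhds p) :=
  ⟨_, ((U.eqLocus (1 : E →L[ℝ] E)).orthogonalProjectionOnto g).2,
    U.tendsto_birkhoffAverage_orthogonalProjection hU g⟩

theorem koopman_exists {α : Type*} [MeasurableSpace α] (μ : Measure α)
    (T : α → α) (hT : MeasurePreserving T μ μ) :
    ∃ U : Lp ℝ 2 μ →L[ℝ] Lp ℝ 2 μ, ‖U‖ ≤ 1 ∧ ∀ h : Lp ℝ 2 μ, U h =ᵐ[μ] h ∘ T := by
  have hb : ∀ h : Lp ℝ 2 μ, ‖Lp.compMeasurePreservingₗ ℝ T hT h‖ ≤ 1 * ‖h‖ := by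
    intro h
    rw [one_mul]
    exact (Lp.norm_compMeasurePreserving h hT).le
  refine ⟨LinearMap.mkContinuous (Lp.compMeasurePreservingₗ ℝ T hT) 1 hb, ?_, ?_⟩
  · exact LinearMap.mkContinuous_norm_le _ zero_le_one _
  · intro h
    exact Lp.coeFn_compMeasurePreserving h hT

theorem mean_ergodic_L1 {α : Type*} [MeasurableSpace α] (μ : Measure α) [IsProbabilityMeasure μ]
    (T : α → α) (hT : Ergodic T μ) (s : Set α) (hs : MeasurableSet s) :
    Tendsto (fun n : ℕ => ∫ ω, |(n : ℝ)⁻¹ * (∑ i ∈ Finset.range n,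
      s.indicator (fun _ => (1 : ℝ)) (T^[i] ω)) - μ.real s| ∂μ) atTop (nhds 0) := by
  have hTm : MeasurePreserving T μ μ := hT.toMeasurePreserving
  set f : α → ℝ := s.indicator (fun _ => (1 : ℝ)) with hf
  have hfm : Measurable f := measurable_const.indicator hs
  have hf01 : ∀ x, |f x| ≤ 1 := by
    intro x
    by_cases hx : x ∈ s <;> simp [hf, hx]
  set g : Lp ℝ 2 μ := indicatorConstLp 2 hs (measure_ne_top μ s) (1 : ℝ) with hg
  have hgf : g =ᵐ[μ] f := indicatorConstLp_coeFn
  obtain ⟨U, hU1, hUc⟩ := koopman_exists μ T hTm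
  obtain ⟨p, hpU, hlim⟩ := hilbert_ergodic U hU1 g
  obtain ⟨c, hc⟩ : ∃ c, p =ᵐ[μ] Function.const α c := by
    apply hT.ae_eq_const_of_ae_eq_comp_ae (Lp.aestronglyMeasurable p)
    have := hUc p
    rw [hpU] at this
    exact this.symm
  have hiter : ∀ i : ℕ, ((U^[i]) g : Lp ℝ 2 μ) =ᵐ[μ] f ∘ T^[i] := by
    intro i
    induction i with
    | zero => simpa using hgf
    | succ i ih =>
      rw [Function.iterate_succ_apply', Function.iterate_succ]
      refine (hUc _).trans ?_
      exact hTm.quasiMeasurePreserving.ae_eq_comp ih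
  have havg : ∀ n : ℕ, (birkhoffAverage ℝ U id n g : Lp ℝ 2 μ) =ᵐ[μ]
      fun ω => (n : ℝ)⁻¹ * ∑ i ∈ Finset.range n, f (T^[i] ω) := by
    intro n
    unfold birkhoffAverage birkhoffSum
    have hsum : (↑(∑ k ∈ Finset.range n, id (U^[k] g)) : α → ℝ) =ᵐ[μ]
        fun ω => ∑ i ∈ Finset.range n, f (T^[i] ω) := by
      induction n with
      | zero => 
        simp only [Finset.range_zero, Finset.sum_empty]
        exact Lp.coeFn_zero ℝ 2 μ
      | succ n ih =>
        rw [Finset.sum_range_succ]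
        refine (Lp.coeFn_add _ _).trans ?_
        filter_upwards [ih, hiter n] with ω h1 h2
        simp only [Pi.add_apply, id] at *
        rw [h1, h2, Finset.sum_range_succ]
        rfl
    refine (Lp.coeFn_smul _ _).trans ?_
    filter_upwards [hsum] with ω h1
    simp only [Pi.smul_apply, h1, smul_eq_mul]
  have hbm : ∀ (n : ℕ) (c : ℝ), Integrable
      (fun ω => (n : ℝ)⁻¹ * (∑ i ∈ Finset.range n, f (T^[i] ω)) - c) μ := by
    intro n c
    refine Integrable.sub (Integrable.const_mul (integrable_finsetSum _ fun i _ => ?_) _)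
      (integrable_const _)
    have : Measurable fun ω => f (T^[i] ω) := hfm.comp (hTm.measurable.iterate i)
    exact (integrable_const (1 : ℝ)).mono' this.aestronglyMeasurable
      (Eventually.of_forall fun ω => hf01 _)
  have hL1 : Tendsto (fun n : ℕ => ∫ ω, |(n : ℝ)⁻¹ * (∑ i ∈ Finset.range n, f (T^[i] ω)) - c| ∂μ)
      atTop (nhds 0) := by
    have h0 : Tendsto (fun n => ‖birkhoffAverage ℝ U id n g - p‖) atTop (nhds 0) := by
      rw [← tendsto_iff_norm_sub_tendsto_zero]
      exact hlim
    refine squeeze_zero (fun n => integral_nonneg fun ω => abs_nonneg _) (fun n => ?_) h0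
    refine le_trans (le_of_eq ?_) (integral_abs_le_Lp_norm μ _)
    apply integral_congr_ae
    filter_upwards [Lp.coeFn_sub (birkhoffAverage ℝ U id n g) p, hc, havg n] with ω h1 h2 h3
    rw [h1, Pi.sub_apply, h2, h3]
    rfl
  have hIntegral : ∀ n : ℕ, 0 < n → ∫ ω, ((n : ℝ)⁻¹ * (∑ i ∈ Finset.range n, f (T^[i] ω)) - c) ∂μ
      = μ.real s - c := by
    intro n hn
    have hfi : ∀ i, Integrable (fun ω => f (T^[i] ω)) μ := by
      intro i
      have : Measurable fun ω => f (T^[i] ω) := hfm.comp (hTm.measurable.iterate i)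
      exact (integrable_const (1 : ℝ)).mono' this.aestronglyMeasurable
        (Eventually.of_forall fun ω => hf01 _)
    rw [integral_sub, integral_const_mul, integral_finsetSum _ (fun i _ => hfi i)]
    · have : ∀ i ∈ Finset.range n, ∫ ω, f (T^[i] ω) ∂μ = μ.real s := by
        intro i _
        have h1 := hTm.iterate i
        rw [← integral_map (φ := T^[i]) h1.measurable.aemeasurable (by
          exact hfm.aestronglyMeasurable), h1.map_eq, hf, integral_indicator_const _ hs]
        simp
      rw [Finset.sum_congr rfl this]
      simp
      field_simp
    · exact (integrable_finsetSum _ fun i _ => hfi i).const_mul _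
    · exact integrable_const _
  have hcs : μ.real s = c := by
    have h1 : Tendsto (fun _ : ℕ => |μ.real s - c|) atTop (nhds 0) := by
      refine squeeze_zero' (Eventually.of_forall fun _ => abs_nonneg _) ?_ hL1
      filter_upwards [eventually_gt_atTop 0] with n hn
      rw [← hIntegral n hn]
      exact abs_integral_le_integral_abs
    have := tendsto_nhds_unique h1 tendsto_const_nhds
    linarith [abs_eq_zero.1 this.symm]
  rw [hcs]
  exact hL1

theorem shift_shift (z y : Pt d) (ω : Config d) : shift z (shift y ω) = shift (y + z) ω := by
  funext w
  simp [shift, add_assoc]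

theorem shift_zero (ω : Config d) : shift 0 ω = ω := by
  funext w
  simp [shift]

theorem shift_iterate (e : Pt d) (i : ℕ) (ω : Config d) :
    (shift e)^[i] ω = shift ((i : ℤ) • e) ω := by
  induction i with
  | zero => simp [shift_zero]
  | succ i ih =>
    rw [Function.iterate_succ_apply', ih, shift_shift]
    congr 1
    push_cast
    rw [add_smul, one_smul]

theorem shift_mp (μ : Measure (Config d)) (herg : ∀ x : Pt d, x ≠ 0 → Ergodic (shift x) μ)
    (x : Pt d) : MeasurePreserving (shift x) μ μ := by
  by_cases hx : x = 0
  · have : shift (0 : Pt d) = id := by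
      funext ω
      simp [shift_zero]
    rw [hx, this]
    exact MeasurePreserving.id μ
  · exact (herg x hx).toMeasurePreserving

open Classical in
theorem box_ncard (x : Pt d) (n : ℕ) (Q : Pt d → Prop) :
    (({y | y ∈ box x n ∧ Q y}).ncard : ℝ) =
      ∑ j : Fin d → Fin n, if Q (x + fun i => ((j i : ℕ) : ℤ)) then (1 : ℝ) else 0 := by
  have himg : {y | y ∈ box x n ∧ Q y} = (fun (j : Fin d → Fin n) => x + fun i => ((j i : ℕ) : ℤ)) ''
      {j | Q (x + fun i => ((j i : ℕ) : ℤ))} := by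
    ext y
    simp only [Set.mem_ofPred_eq, Set.mem_image]
    constructor
    · rintro ⟨hb, hq⟩
      have hy : (x + fun i => ((y i - x i).toNat : ℤ)) = y := by
        funext i
        have := hb i
        simp only [Pi.add_apply]
        omega
      refine ⟨fun i => ⟨(y i - x i).toNat, by have := hb i; omega⟩, ?_, ?_⟩
      · simpa only [hy] using hq
      · exact hy
    · rintro ⟨j, hj, rfl⟩
      refine ⟨fun i => ?_, hj⟩
      have := (j i).2
      simp only [Pi.add_apply]
      omega
  have hinj : Function.Injective (fun (j : Fin d → Fin n) => x + fun i => ((j i : ℕ) : ℤ)) := by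
    intro j j' h
    funext i
    have := congrFun h i
    simp only [Pi.add_apply] at this
    apply Fin.ext
    omega
  rw [himg, Set.ncard_image_of_injective _ hinj, Set.ncard_eq_toFinset_card', Finset.sum_boole]
  congr 2
  ext j
  simp

open Classical in
theorem box_density_succ {m : ℕ} (μ : Measure (Config (m+1))) [IsProbabilityMeasure μ]
    (herg : ∀ x : Pt (m+1), x ≠ 0 → Ergodic (shift x) μ) (s : Set (Config (m+1)))
    (hs : MeasurableSet s) (c q : ℝ) (hc : 0 < c) (hq : 0 < q) :
    ∃ N : ℕ, ∀ n : ℕ, N ≤ n → ∀ x : Pt (m+1),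
      μ.real {ω | c * (n : ℝ) ^ (m+1) ≤
        |((({y | y ∈ box x n ∧ shift y ω ∈ s}).ncard : ℝ)) - μ.real s * (n : ℝ) ^ (m+1)|} ≤ q := by
  set e : Pt (m+1) := Pi.single 0 1 with he
  have he0 : e ≠ 0 := by simp [he]
  set f : Config (m+1) → ℝ := s.indicator (fun _ => (1 : ℝ)) with hf
  have hfm : Measurable f := measurable_const.indicator hs
  have hlim := mean_ergodic_L1 μ (shift e) (herg e he0) s hs
  have hev := hlim.eventually (gt_mem_nhds (show (0 : ℝ) < c * q by positivity))
  obtain ⟨N, hN⟩ := eventually_atTop.1 (hev.and (eventually_gt_atTop 0))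
  refine ⟨N, fun n hn x => ?_⟩
  obtain ⟨hε, hn0⟩ := hN n hn
  have hnR : (0 : ℝ) < n := by exact_mod_cast hn0
  set h : Config (m+1) → ℝ := fun ω => (n : ℝ)⁻¹ * (∑ i ∈ Finset.range n, f ((shift e)^[i] ω)) -
    μ.real s with hh
  have hmp := shift_mp μ herg
  have hhm : Measurable h := by
    refine Measurable.sub_const (Measurable.const_mul ?_ _) _
    exact Finset.measurable_fun_sum _ fun i _ => hfm.comp ((hmp e).measurable.iterate i)
  have hf01 : ∀ ω, 0 ≤ f ω ∧ f ω ≤ 1 := by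
    intro ω
    by_cases hx : ω ∈ s <;> simp [hf, hx]
  have hfi : ∀ g : Config (m+1) → Config (m+1), Measurable g → Integrable (fun ω => f (g ω)) μ := by
    intro g hg
    refine (integrable_const (1 : ℝ)).mono' (hfm.comp hg).aestronglyMeasurable
      (Eventually.of_forall fun ω => ?_)
    rw [Real.norm_eq_abs, abs_of_nonneg (hf01 _).1]
    exact (hf01 _).2
  have hhi : Integrable h μ :=
    ((integrable_finsetSum _ fun i _ => hfi _ ((hmp e).measurable.iterate i)).const_mul _).sub
      (integrable_const _)
  let z : (Fin m → Fin n) → Pt (m+1) := fun j => x + Fin.cons (0 : ℤ) (fun i => ((j i : ℕ) : ℤ))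
  -- The count minus its mean is a sum of line averages.
  have hcount : ∀ ω, (((({y | y ∈ box x n ∧ shift y ω ∈ s}).ncard : ℝ)) - μ.real s * (n : ℝ) ^ (m+1))
      = ∑ j : Fin m → Fin n, (n : ℝ) * h (shift (z j) ω) := by
    intro ω
    rw [box_ncard x n (fun y => shift y ω ∈ s)]
    have h1 : ∀ j : Fin m → Fin n, (n : ℝ) * h (shift (z j) ω) =
        (∑ i : Fin n, f (shift (x + fun k => (((Fin.cons i j : Fin (m+1) → Fin n) k : ℕ) : ℤ)) ω))
          - n * μ.real s := by
      intro j
      simp only [hh]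
      rw [mul_sub, ← mul_assoc, mul_inv_cancel₀ hnR.ne', one_mul, Finset.sum_range]
      congr 1
      apply Finset.sum_congr rfl
      intro i _
      rw [shift_iterate, shift_shift]
      congr 2
      funext k
      simp only [z, Pi.add_apply, he]
      refine Fin.cases ?_ (fun k => ?_) k
      · simp
      · simp
    rw [Finset.sum_congr rfl fun j _ => h1 j, Finset.sum_sub_distrib]
    congr 1
    · rw [← (Fin.consEquiv (fun _ : Fin (m+1) => Fin n)).sum_comp, Fintype.sum_prod_type,
        Finset.sum_comm]
      refine Finset.sum_congr rfl fun j _ => Finset.sum_congr rfl fun i _ => ?_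
      simp only [Fin.consEquiv_apply, hf, Set.indicator_apply]
    · simp
      ring
  set D : Config (m+1) → ℝ := fun ω => ∑ j : Fin m → Fin n, (n : ℝ) * |h (shift (z j) ω)| with hD
  have hDi : Integrable D μ := by
    refine integrable_finsetSum _ fun j _ => Integrable.const_mul ?_ _
    exact ((hmp (z j)).integrable_comp hhi.abs.aestronglyMeasurable).2 hhi.abs
  have hDint : ∫ ω, D ω ∂μ = (n : ℝ) ^ (m+1) * ∫ ω, |h ω| ∂μ := by
    simp only [hD]
    rw [integral_finsetSum]
    · have : ∀ j : Fin m → Fin n, ∫ ω, (n : ℝ) * |h (shift (z j) ω)| ∂μ =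
          (n : ℝ) * ∫ ω, |h ω| ∂μ := by
        intro j
        rw [integral_const_mul]
        congr 1
        rw [← integral_map (φ := shift (z j)) (f := fun ω => |h ω|) (hmp (z j)).measurable.aemeasurable
          hhm.abs.aestronglyMeasurable, (hmp (z j)).map_eq]
      rw [Finset.sum_congr rfl fun j _ => this j]
      simp
      ring
    · intro j _
      exact (((hmp (z j)).integrable_comp hhi.abs.aestronglyMeasurable).2 hhi.abs).const_mul _
  have hpos : (0 : ℝ) < c * (n : ℝ) ^ (m+1) := by positivity
  have hmark := mul_meas_ge_le_integral_of_nonneg (μ := μ) (f := D)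
    (Eventually.of_forall fun ω => Finset.sum_nonneg fun j _ => by positivity) hDi
    (c * (n : ℝ) ^ (m+1))
  have hsub : μ.real {ω | c * (n : ℝ) ^ (m+1) ≤
        |((({y | y ∈ box x n ∧ shift y ω ∈ s}).ncard : ℝ)) - μ.real s * (n : ℝ) ^ (m+1)|} ≤
      μ.real {ω | c * (n : ℝ) ^ (m+1) ≤ D ω} := by
    apply measureReal_mono _ (measure_ne_top _ _)
    intro ω hω
    simp only [Set.mem_ofPred_eq] at hω ⊢
    rw [hcount ω] at hω
    refine hω.trans ((Finset.abs_sum_le_sum_abs _ _).trans (le_of_eq ?_))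
    refine Finset.sum_congr rfl fun j _ => ?_
    rw [abs_mul, abs_of_pos hnR]
  refine hsub.trans ?_
  rw [hDint] at hmark
  have h2 : (n : ℝ) ^ (m+1) * ∫ ω, |h ω| ∂μ ≤ (n : ℝ) ^ (m+1) * (c * q) :=
    mul_le_mul_of_nonneg_left hε.le (by positivity)
  have h3 : c * (n : ℝ) ^ (m+1) * μ.real {ω | c * (n : ℝ) ^ (m+1) ≤ D ω} ≤
      c * (n : ℝ) ^ (m+1) * q := by
    refine hmark.trans (h2.trans (le_of_eq (by ring)))
  exact le_of_mul_le_mul_left h3 hpos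

theorem box_density (hd : 2 ≤ d) (μ : Measure (Config d)) [IsProbabilityMeasure μ]
    (herg : ∀ x : Pt d, x ≠ 0 → Ergodic (shift x) μ) (s : Set (Config d))
    (hs : MeasurableSet s) (c q : ℝ) (hc : 0 < c) (hq : 0 < q) :
    ∃ N : ℕ, ∀ n : ℕ, N ≤ n → ∀ x : Pt d,
      μ.real {ω | c * (n : ℝ) ^ d ≤
        |((({y | y ∈ box x n ∧ shift y ω ∈ s}).ncard : ℝ)) - μ.real s * (n : ℝ) ^ d|} ≤ q := by
  obtain ⟨m, rfl⟩ : ∃ m, d = m + 1 := ⟨d - 1, by omega⟩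
  exact box_density_succ μ herg s hs c q hc hq

/-- Increasing version of `eventA`. -/
def goodA (d : ℕ) (η : ℝ) (L0 : ℕ) (x : Pt d) : Set (Config d) :=
  {ω | ∃ w : (Fin d → Bool) → Pt d,
    (∀ e, w e ∈ Sr ω (L0 : ℝ) ∩ box (subCorner x L0 e) L0 ∧ (3/4 : ℝ) * η * (L0 : ℝ) ^ d ≤
      (cluster (Sr ω (L0 : ℝ) ∩ box (subCorner x L0 e) L0) (w e)).ncard) ∧
    ∀ e e', connIn (SS ω ∩ box x (2*L0)) (w e) (w e')}

theorem subbox_subset (x : Pt d) (L0 : ℕ) (e : Fin d → Bool) :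
    box (subCorner x L0 e) L0 ⊆ box x (2*L0) := by
  intro y hy i
  have := hy i
  unfold subCorner at this
  push_cast
  split_ifs at this <;> omega

theorem cluster_subset (T : Set (Pt d)) (x : Pt d) : cluster T x ⊆ T := fun _ h => h.2.1

theorem goodA_eventB_subset (η : ℝ) (hη : 0 < η) (L0 : ℕ) (hL : 0 < L0) (x : Pt d) :
    goodA d η L0 x ∩ eventB d η L0 x ⊆ eventA d η L0 x := by
  rintro ω ⟨⟨w, hw, hww⟩, hB⟩
  refine ⟨fun e => ⟨_, ⟨w e, (hw e).1, rfl⟩, (hw e).2⟩, ?_⟩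
  have key : ∀ e C y, bigCompIn ω η L0 (box (subCorner x L0 e) L0) C → y ∈ C →
      connIn (SS ω ∩ box x (2*L0)) y (w e) := by
    rintro e C y ⟨⟨v, hv, rfl⟩, hC⟩ hy
    set T := Sr ω (L0 : ℝ) ∩ box (subCorner x L0 e) L0 with hT
    have hTf : T.Finite := (box_finite _ _).subset Set.inter_subset_right
    have hTS : T ⊆ SS ω ∩ box x (2*L0) := fun z hz => ⟨hz.1.1, subbox_subset x L0 e hz.2⟩
    have hnd : ¬ Disjoint (cluster T v) (cluster T (w e)) := by
      intro hdis
      have h1 := Set.ncard_union_eq hdis (hTf.subset (cluster_subset _ _))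
        (hTf.subset (cluster_subset _ _))
      have h2 : (cluster T v ∪ cluster T (w e)).ncard ≤ T.ncard :=
        Set.ncard_le_ncard (Set.union_subset (cluster_subset _ _) (cluster_subset _ _)) hTf
      have h3 := hB e
      have h4 := (hw e).2
      rw [← hT] at h3 h4
      rw [h1] at h2
      have h5 : ((cluster T v).ncard : ℝ) + (cluster T (w e)).ncard ≤ T.ncard := by
        exact_mod_cast h2
      have h6 : 0 < η * (L0 : ℝ) ^ d := by positivity
      linarith
    obtain ⟨p, hp, hp'⟩ := Set.not_disjoint_iff.1 hnd
    exact connIn_mono hTS (connIn_trans (connIn_symm hy) (connIn_trans hp (connIn_symm hp')))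
  intro e e' C C' y z hC hC' hy hz
  exact connIn_trans (key e C y hC hy) (connIn_trans (hww e e') (connIn_symm (key e' C' z hC' hz)))

theorem goodA_compl_decreasing (η : ℝ) (L0 : ℕ) (x : Pt d) :
    DecreasingEvent (goodA d η L0 x)ᶜ := by
  intro ω ω' h hω hω'
  apply hω
  obtain ⟨w, hw, hww⟩ := hω'
  refine ⟨w, fun e => ⟨⟨Sr_mono h _ (hw e).1.1, (hw e).1.2⟩, (hw e).2.trans ?_⟩, fun e e' =>
    connIn_mono (Set.inter_subset_inter_left _ (SS_mono h)) (hww e e')⟩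
  have : cluster (Sr ω' (L0 : ℝ) ∩ box (subCorner x L0 e) L0) (w e) ⊆
      cluster (Sr ω (L0 : ℝ) ∩ box (subCorner x L0 e) L0) (w e) := fun y hy =>
    connIn_mono (Set.inter_subset_inter_left _ (Sr_mono h _)) hy
  exact_mod_cast Set.ncard_le_ncard this
    (((box_finite _ _).subset Set.inter_subset_right).subset (cluster_subset _ _))

theorem eventB_compl_increasing (η : ℝ) (L0 : ℕ) (x : Pt d) :
    IncreasingEvent (eventB d η L0 x)ᶜ := by
  intro ω ω' h hω hω'
  apply hω
  intro e
  refine le_trans ?_ (hω' e)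
  exact_mod_cast Set.ncard_le_ncard (Set.inter_subset_inter_left _ (Sr_mono h _))
    ((box_finite _ _).subset Set.inter_subset_right)

theorem dependsOn_compl {G : Set (Config d)} {B : Set (Pt d)} (h : DependsOn G B) :
    DependsOn Gᶜ B := fun ω ω' hw => not_congr (h ω ω' hw)

theorem dependsOn_mono {G : Set (Config d)} {B B' : Set (Pt d)} (hB : B ⊆ B') (h : DependsOn G B) :
    DependsOn G B' := fun ω ω' hw => h ω ω' fun x hx => hw x (hB hx)

theorem box_ball_subset (x : Pt d) (L0 : ℕ) (y : Pt d) (hy : y ∈ box x (2*L0)) :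
    ballZ y L0 ⊆ ballZ x (10*L0) := by
  intro z hz
  rw [mem_ballZ_iff] at *
  intro i
  have h1 := hz i
  have h2 := hy i
  push_cast at h2
  omega

theorem box_subset_ball (x : Pt d) (L0 : ℕ) : box x (2*L0) ⊆ ballZ x (10*L0) := fun y hy =>
  box_ball_subset x L0 y hy (by simp [mem_ballZ_iff])

theorem goodA_dependsOn (η : ℝ) (L0 : ℕ) (x : Pt d) :
    DependsOn (goodA d η L0 x) (ballZ x (10*L0)) := by
  intro ω ω' h
  unfold goodA
  simp only [Set.mem_ofPred_eq]
  have h1 : ∀ e, Sr ω (L0 : ℝ) ∩ box (subCorner x L0 e) L0 =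
      Sr ω' (L0 : ℝ) ∩ box (subCorner x L0 e) L0 := fun e =>
    Sr_inter_congr L0 (fun y hy => box_ball_subset x L0 y (subbox_subset x L0 e hy)) h
  have h2 : SS ω ∩ box x (2*L0) = SS ω' ∩ box x (2*L0) :=
    SS_inter_congr fun y hy => h y (box_subset_ball x L0 hy)
  simp only [h1, h2]

theorem eventB_dependsOn (η : ℝ) (L0 : ℕ) (x : Pt d) :
    DependsOn (eventB d η L0 x) (ballZ x (10*L0)) := by
  intro ω ω' h
  unfold eventB
  simp only [Set.mem_ofPred_eq]
  have h1 : ∀ e, Sr ω (L0 : ℝ) ∩ box (subCorner x L0 e) L0 =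
      Sr ω' (L0 : ℝ) ∩ box (subCorner x L0 e) L0 := fun e =>
    Sr_inter_congr L0 (fun y hy => box_ball_subset x L0 y (subbox_subset x L0 e hy)) h
  simp only [h1]

/-! Seed estimates -/

theorem tendsto_Sr (μ : Measure (Config d)) [IsProbabilityMeasure μ] :
    Tendsto (fun M : ℕ => μ.real {ω | (0 : Pt d) ∈ Sr ω (M : ℝ)}) atTop (nhds (eta d μ)) := by
  unfold eta
  rw [Sinf_eq]
  refine (ENNReal.tendsto_toReal (measure_ne_top _ _)).comp ?_
  refine tendsto_measure_iInter_atTop (fun n => (measurableSet_Sr 0 _).nullMeasurableSet) ?_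
    ⟨0, measure_ne_top _ _⟩
  intro m n hmn ω hω
  exact Sr_anti ω (by exact_mod_cast hmn) hω

theorem seedB (hd : 2 ≤ d) (μ : Measure (Config d)) [IsProbabilityMeasure μ]
    (herg : ∀ x : Pt d, x ≠ 0 → Ergodic (shift x) μ) (η : ℝ) (hη : 0 < η)
    (hμ : eta d μ < (11/10) * η) (q : ℝ) (hq : 0 < q) :
    ∃ N : ℕ, ∀ L0 : ℕ, N ≤ L0 → ∀ x : Pt d, μ.real (eventB d η L0 x)ᶜ ≤ q := by
  obtain ⟨M, hM⟩ := (tendsto_Sr μ |>.eventually (gt_mem_nhds hμ)).exists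
  obtain ⟨N, hN⟩ := box_density hd μ herg {ω | (0 : Pt d) ∈ Sr ω (M : ℝ)} (measurableSet_Sr 0 _)
    (η / 10) (q / 2 ^ d) (by positivity) (by positivity)
  refine ⟨max M N, fun L0 hL x => ?_⟩
  have hML : M ≤ L0 := le_trans (le_max_left _ _) hL
  have hNL : N ≤ L0 := le_trans (le_max_right _ _) hL
  have hsub : (eventB d η L0 x)ᶜ ⊆ ⋃ e : Fin d → Bool, {ω | η / 10 * (L0 : ℝ) ^ d ≤
        |((({y | y ∈ box (subCorner x L0 e) L0 ∧ shift y ω ∈ {ω | (0 : Pt d) ∈ Sr ω (M : ℝ)}}).ncard : ℝ))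
          - μ.real {ω | (0 : Pt d) ∈ Sr ω (M : ℝ)} * (L0 : ℝ) ^ d|} := by
    intro ω hω
    simp only [eventB, Set.mem_compl_iff, Set.mem_ofPred_eq, not_forall, not_le] at hω
    obtain ⟨e, he⟩ := hω
    refine Set.mem_iUnion.2 ⟨e, ?_⟩
    simp only [Set.mem_ofPred_eq]
    have h1 : (Sr ω (L0 : ℝ) ∩ box (subCorner x L0 e) L0).ncard ≤
        ({y | y ∈ box (subCorner x L0 e) L0 ∧ (0 : Pt d) ∈ Sr (shift y ω) (M : ℝ)}).ncard := by
      apply Set.ncard_le_ncard _ ((box_finite _ _).subset fun y hy => hy.1)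
      rintro y ⟨hy1, hy2⟩
      refine ⟨hy2, ?_⟩
      rw [mem_Sr_shift, add_zero]
      exact Sr_anti ω (by exact_mod_cast hML) hy1
    have h1' : ((Sr ω (L0 : ℝ) ∩ box (subCorner x L0 e) L0).ncard : ℝ) ≤
        ({y | y ∈ box (subCorner x L0 e) L0 ∧ (0 : Pt d) ∈ Sr (shift y ω) (M : ℝ)}).ncard := by
      exact_mod_cast h1
    have h2 : μ.real {ω | (0 : Pt d) ∈ Sr ω (M : ℝ)} * (L0 : ℝ) ^ d ≤
        (11/10) * η * (L0 : ℝ) ^ d := mul_le_mul_of_nonneg_right hM.le (by positivity)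
    have h3 : 0 ≤ η * (L0 : ℝ) ^ d := by positivity
    refine le_trans ?_ (le_abs_self _)
    linarith
  refine (measureReal_mono hsub (measure_ne_top _ _)).trans ?_
  refine (measureReal_iUnion_fintype_le _).trans ?_
  refine (Finset.sum_le_sum fun e _ => hN L0 hNL (subCorner x L0 e)).trans ?_
  simp
  field_simp
  exact le_rfl

/-- All grid points `x + ρ j`, `j ∈ [0,J]^d` satisfy local uniqueness. -/
def gridGood (x : Pt d) (ρ J : ℕ) : Set (Config d) :=
  {ω | ∀ j : Fin d → Fin (J+1),
    shift (x + fun i => (ρ : ℤ) * ((j i : ℕ) : ℤ)) ω ∈ locUniq1 d ρ ∩ locUniq2 d (2*ρ)}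

theorem gridGood_prob (μ : Measure (Config d)) [IsProbabilityMeasure μ]
    (herg : ∀ x : Pt d, x ≠ 0 → Ergodic (shift x) μ) (g : ℕ → ℝ)
    (hg : Tendsto g atTop (nhds 0)) (h1 : ∀ R : ℕ, 1 ≤ R → 1 - g R ≤ (μ (locUniq1 d R)).toReal)
    (h2 : ∀ R : ℕ, 1 ≤ R → 1 - g R ≤ (μ (locUniq2 d R)).toReal) (J : ℕ) (q : ℝ) (hq : 0 < q) :
    ∃ N : ℕ, ∀ ρ : ℕ, N ≤ ρ → ∀ x : Pt d, μ.real (gridGood x ρ J)ᶜ ≤ q := by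
  have hq' : 0 < q / (2 * (J + 1) ^ d) := by positivity
  obtain ⟨N, hN⟩ := eventually_atTop.1 (hg.eventually (gt_mem_nhds hq'))
  refine ⟨max N 1, fun ρ hρ x => ?_⟩
  have hρN : N ≤ ρ := le_trans (le_max_left _ _) hρ
  have hρ1 : 1 ≤ ρ := le_trans (le_max_right _ _) hρ
  have hsub : (gridGood x ρ J)ᶜ ⊆ ⋃ j : Fin d → Fin (J+1),
      (shift (x + fun i => (ρ : ℤ) * ((j i : ℕ) : ℤ)) ⁻¹' (locUniq1 d ρ)ᶜ ∪
       shift (x + fun i => (ρ : ℤ) * ((j i : ℕ) : ℤ)) ⁻¹' (locUniq2 d (2*ρ))ᶜ) := by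
    intro ω hω
    simp only [gridGood, Set.mem_compl_iff, Set.mem_ofPred_eq, not_forall] at hω
    obtain ⟨j, hj⟩ := hω
    refine Set.mem_iUnion.2 ⟨j, ?_⟩
    simp only [Set.mem_inter_iff, Set.mem_union, Set.mem_preimage, Set.mem_compl_iff] at *
    tauto
  have hb : ∀ z : Pt d, μ.real (shift z ⁻¹' (locUniq1 d ρ)ᶜ ∪ shift z ⁻¹' (locUniq2 d (2*ρ))ᶜ) ≤
      2 * (q / (2 * (J + 1) ^ d)) := by
    intro z
    refine (measureReal_union_le _ _).trans ?_
    rw [(shift_mp μ herg z).measureReal_preimage (measurableSet_locUniq1 ρ).compl.nullMeasurableSet,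
      (shift_mp μ herg z).measureReal_preimage (measurableSet_locUniq2 (2*ρ)).compl.nullMeasurableSet,
      probReal_compl_eq_one_sub (measurableSet_locUniq1 ρ),
      probReal_compl_eq_one_sub (measurableSet_locUniq2 (2*ρ))]
    have e1 := h1 ρ hρ1
    have e2 := h2 (2*ρ) (by omega)
    have e3 := hN ρ hρN
    have e4 := hN (2*ρ) (by omega)
    unfold Measure.real
    linarith
  refine (measureReal_mono hsub (measure_ne_top _ _)).trans ?_
  refine (measureReal_iUnion_fintype_le _).trans ?_
  refine (Finset.sum_le_sum fun j _ => hb _).trans ?_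
  simp
  field_simp
  exact le_rfl

/-- Chaining on the grid. -/
theorem grid_chain (V : (Fin d → ℤ) → Prop) (Q : (Fin d → ℤ) → (Fin d → ℤ) → Prop)
    (lo hi : ℤ) (hV : ∀ j, V j ↔ ∀ i, lo ≤ j i ∧ j i ≤ hi)
    (h1 : ∀ j j', V j → V j' → (∀ i, (j i - j' i).natAbs ≤ 1) → Q j j')
    (ht : ∀ j j' j'', Q j j' → Q j' j'' → Q j j'') (j j' : Fin d → ℤ) (hj : V j) (hj' : V j') :
    Q j j' := by
  have key : ∀ t : ℕ, ∀ j, V j → (∀ i, (j i - j' i).natAbs ≤ t) → Q j j' := by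
    intro t
    induction t with
    | zero =>
      intro j hj h
      exact h1 j j' hj hj' fun i => (h i).trans (by omega)
    | succ t ih =>
      intro j hj h
      let k : Fin d → ℤ := fun i => if j i < j' i then j i + 1 else if j' i < j i then j i - 1 else j i
      have hk : ∀ i, (j i - k i).natAbs ≤ 1 ∧ (k i - j' i).natAbs ≤ t ∧ lo ≤ k i ∧ k i ≤ hi := by
        intro i
        have e1 := h i
        have e2 := (hV j).1 hj i
        have e3 := (hV j').1 hj' i
        simp only [k]
        split_ifs <;> omega
      have hVk : V k := (hV k).2 fun i => (hk i).2.2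
      exact ht j k j' (h1 j k hj hVk fun i => (hk i).1) (ih k hVk fun i => (hk i).2.1)
  exact key (distInf j j') j hj (natAbs_le_distInf j j')

theorem grid_connected (x : Pt d) (ρ J N : ℕ) (hρ : 1 ≤ ρ) (hJ : N ≤ J * ρ) (ω : Config d)
    (hω : ω ∈ gridGood x ρ J) (y y' : Pt d) (hy : y ∈ Sinf ω) (hy' : y' ∈ Sinf ω)
    (hyb : ∀ i, x i + 4 * ρ ≤ y i ∧ y i + 4 * ρ < x i + N)
    (hyb' : ∀ i, x i + 4 * ρ ≤ y' i ∧ y' i + 4 * ρ < x i + N) :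
    connIn (SS ω ∩ box x N) y y' := by
  have hρZ : (0 : ℤ) < ρ := by exact_mod_cast hρ
  let zz : (Fin d → ℤ) → Pt d := fun j => x + fun i => (ρ : ℤ) * j i
  let hi : ℤ := ((N : ℤ) - 1 - 4 * ρ) / ρ
  let V : (Fin d → ℤ) → Prop := fun j => ∀ i, 4 ≤ j i ∧ j i ≤ hi
  have hhi : ∀ t : ℤ, t ≤ hi ↔ t * ρ + 4 * ρ < N := by
    intro t
    rw [Int.le_ediv_iff_mul_le hρZ]
    omega
  have hJ' : (N : ℤ) ≤ J * ρ := by exact_mod_cast hJ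
  have hloc : ∀ j, V j → shift (zz j) ω ∈ locUniq1 d ρ ∩ locUniq2 d (2*ρ) := by
    intro j hj
    have hlt : ∀ i, (j i).toNat < J + 1 := by
      intro i
      have h1 := hj i
      have h2 := (hhi (j i)).1 h1.2
      have h3 : j i * ρ < J * ρ := by linarith
      have h4 : j i < J := lt_of_mul_lt_mul_right h3 hρZ.le
      omega
    have := hω (fun i => ⟨(j i).toNat, hlt i⟩)
    have he : (x + fun i => (ρ : ℤ) * (((⟨(j i).toNat, hlt i⟩ : Fin (J+1)) : ℕ) : ℤ)) = zz j := by
      funext i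
      have h1 := (hj i).1
      simp only [Pi.add_apply, zz]
      rw [Int.toNat_of_nonneg (by omega)]
    rwa [he] at this
  have hball : ∀ j, V j → ballZ (zz j) (2*(2*ρ)) ⊆ box x N := by
    intro j hj w hw i
    rw [mem_ballZ_iff] at hw
    have h1 := hw i
    have h2 := (hhi (j i)).1 (hj i).2
    have h3 : 4 * (ρ : ℤ) ≤ j i * ρ := mul_le_mul_of_nonneg_right (hj i).1 hρZ.le
    simp only [zz, Pi.add_apply] at h1
    rw [mul_comm (ρ : ℤ) (j i)] at h1
    generalize j i * (ρ : ℤ) = t at *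
    omega
  have hpex : ∀ j, V j → ∃ p, p ∈ Sr ω (ρ : ℝ) ∧ p ∈ ballZ (zz j) ρ := by
    intro j hj
    obtain ⟨p, hp1, hp2⟩ := (hloc j hj).1
    rw [mem_Sr_shift] at hp1
    refine ⟨zz j + p, hp1, ?_⟩
    rw [mem_ballZ_iff] at *
    intro i
    have := hp2 i
    simp only [Pi.add_apply, Pi.zero_apply] at *
    omega
  have hu : ∀ j, V j → ∀ p q, p ∈ Sr ω (ρ : ℝ) → q ∈ Sr ω (ρ : ℝ) → p ∈ ballZ (zz j) (2*ρ) →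
      q ∈ ballZ (zz j) (2*ρ) → connIn (SS ω ∩ box x N) p q := by
    intro j hj p q hp hq hpb hqb
    have hle : (((2*ρ : ℕ) : ℝ)/10) ≤ ρ := by
      push_cast
      have : (0 : ℝ) ≤ ρ := by positivity
      linarith
    have h2 := (hloc j hj).2
    have aux : ∀ p, p ∈ Sr ω (ρ : ℝ) → p ∈ ballZ (zz j) (2*ρ) →
        -zz j + p ∈ Sr (shift (zz j) ω) (((2*ρ : ℕ) : ℝ)/10) ∩ ballZ (0 : Pt d) (2*ρ) := by
      intro p hp hpb
      constructor
      · rw [mem_Sr_shift]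
        simpa using Sr_anti ω hle hp
      · rw [mem_ballZ_iff] at *
        intro i
        have := hpb i
        simp only [Pi.add_apply, Pi.zero_apply, Pi.neg_apply] at *
        omega
    have h3 := h2 _ (aux p hp hpb) _ (aux q hq hqb)
    have h4 : SS (shift (zz j) ω) ∩ ballZ (0 : Pt d) (2*(2*ρ)) ⊆
        {w | zz j + w ∈ SS ω ∩ box x N} := by
      rintro w ⟨hw1, hw2⟩
      refine ⟨hw1, hball j hj ?_⟩
      rw [mem_ballZ_iff] at *
      intro i
      have := hw2 i
      simp only [Pi.add_apply, Pi.zero_apply] at *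
      omega
    have h5 := connIn_shift _ _ _ (connIn_mono h4 h3)
    simpa using h5
  let Q : (Fin d → ℤ) → (Fin d → ℤ) → Prop := fun j j' => V j ∧ V j' ∧
    ∀ p q, p ∈ Sr ω (ρ : ℝ) → q ∈ Sr ω (ρ : ℝ) → p ∈ ballZ (zz j) ρ →
      q ∈ ballZ (zz j') ρ → connIn (SS ω ∩ box x N) p q
  have hQ1 : ∀ j j', V j → V j' → (∀ i, (j i - j' i).natAbs ≤ 1) → Q j j' := by
    intro j j' hj hj' hjj
    refine ⟨hj, hj', fun p q hp hq hpb hqb => hu j hj p q hp hq ?_ ?_⟩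
    · rw [mem_ballZ_iff] at *
      intro i
      have := hpb i
      omega
    · rw [mem_ballZ_iff] at *
      intro i
      have h1 := hqb i
      have h2 := hjj i
      have h3 : j i = j' i ∨ j i = j' i + 1 ∨ j i = j' i - 1 := by omega
      simp only [zz, Pi.add_apply] at *
      rcases h3 with h3 | h3 | h3 <;> rw [h3]
      · omega
      · rw [mul_add]
        generalize (ρ : ℤ) * j' i = t at *
        omega
      · rw [mul_sub]
        generalize (ρ : ℤ) * j' i = t at *
        omega
  have hQt : ∀ j j' j'', Q j j' → Q j' j'' → Q j j'' := by
    intro j j' j'' h h'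
    refine ⟨h.1, h'.2.1, fun p q hp hq hpb hqb => ?_⟩
    obtain ⟨r, hr, hrb⟩ := hpex j' h.2.1
    exact connIn_trans (h.2.2 p r hp hr hpb hrb) (h'.2.2 r q hr hq hrb hqb)
  have hcell : ∀ y : Pt d, (∀ i, x i + 4 * ρ ≤ y i ∧ y i + 4 * ρ < x i + N) →
      V (fun i => (y i - x i) / ρ) ∧ y ∈ ballZ (zz fun i => (y i - x i) / ρ) ρ := by
    intro y hyb
    have hdm : ∀ i, (ρ : ℤ) * ((y i - x i) / ρ) ≤ y i - x i ∧
        y i - x i < (ρ : ℤ) * ((y i - x i) / ρ) + ρ := by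
      intro i
      have h1 := Int.mul_ediv_add_emod (y i - x i) ρ
      have h2 := Int.emod_nonneg (y i - x i) hρZ.ne'
      have h3 := Int.emod_lt_of_pos (y i - x i) hρZ
      constructor <;> linarith
    constructor
    · intro i
      have h1 := hyb i
      have h2 := hdm i
      refine ⟨?_, ?_⟩
      · rw [Int.le_ediv_iff_mul_le hρZ]
        linarith
      · rw [hhi, mul_comm]
        linarith
    · rw [mem_ballZ_iff]
      intro i
      have h2 := hdm i
      simp only [zz, Pi.add_apply]
      generalize (ρ : ℤ) * ((y i - x i) / ρ) = t at *
      omega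
  obtain ⟨hV1, hb1⟩ := hcell y hyb
  obtain ⟨hV2, hb2⟩ := hcell y' hyb'
  exact (grid_chain V Q 4 hi (fun j => Iff.rfl) hQ1 hQt _ _ hV1 hV2).2.2 y y'
    (Sinf_subset_Sr ω _ hy) (Sinf_subset_Sr ω _ hy') hb1 hb2

theorem seedA (hd : 2 ≤ d) (μ : Measure (Config d)) [IsProbabilityMeasure μ]
    (herg : ∀ x : Pt d, x ≠ 0 → Ergodic (shift x) μ) (g : ℕ → ℝ)
    (hg : Tendsto g atTop (nhds 0)) (h1 : ∀ R : ℕ, 1 ≤ R → 1 - g R ≤ (μ (locUniq1 d R)).toReal)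
    (h2 : ∀ R : ℕ, 1 ≤ R → 1 - g R ≤ (μ (locUniq2 d R)).toReal) (η : ℝ) (hη : 0 < η)
    (hμ : (96/100) * η < eta d μ) (q : ℝ) (hq : 0 < q) :
    ∃ N : ℕ, ∀ L0 : ℕ, N ≤ L0 → ∀ x : Pt d, μ.real (goodA d η L0 x)ᶜ ≤ q := by
  set K : ℕ := 80 * d with hK
  have hK0 : 0 < K := by omega
  obtain ⟨N1, hN1⟩ := box_density hd μ herg {ω | (0 : Pt d) ∈ Sinf ω} (measurableSet_Sinf 0)
    ((6/100) * η) (q / (3 * 2 ^ d)) (by positivity) (by positivity)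
  obtain ⟨N2, hN2⟩ := gridGood_prob μ herg g hg h1 h2 (4 * K) (q / (3 * 2 ^ d)) (by positivity)
  refine ⟨K * (N1 + N2 + 1), fun L0 hL x => ?_⟩
  set ρ : ℕ := L0 / K with hρdef
  have hρ : N1 + N2 + 1 ≤ ρ := by
    rw [hρdef, Nat.le_div_iff_mul_le hK0, mul_comm]
    exact hL
  have hρK : K * ρ ≤ L0 := Nat.mul_div_le L0 K
  have hρK' : L0 < K * (ρ + 1) := Nat.lt_mul_div_succ L0 hK0
  have hρK2 : L0 ≤ 2 * (K * ρ) := by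
    have : K * 1 ≤ K * ρ := Nat.mul_le_mul_left K (by omega)
    rw [mul_add] at hρK'
    omega
  have h160 : 160 * ρ ≤ K * ρ := Nat.mul_le_mul_right ρ (by omega)
  set n : ℕ := L0 - 8 * ρ with hn
  have hn8 : n + 8 * ρ = L0 := by omega
  have hnN : N1 ≤ n := by omega
  let cc : (Fin d → Bool) → Pt d := fun e i => subCorner x L0 e i + 4 * ρ
  have hsub : (goodA d η L0 x)ᶜ ⊆ (⋃ e : Fin d → Bool, ({ω | (6/100) * η * (n : ℝ) ^ d ≤
        |((({y | y ∈ box (cc e) n ∧ shift y ω ∈ {ω | (0 : Pt d) ∈ Sinf ω}}).ncard : ℝ))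
          - μ.real {ω | (0 : Pt d) ∈ Sinf ω} * (n : ℝ) ^ d|} ∪ (gridGood (subCorner x L0 e) ρ (4*K))ᶜ)) ∪
        (gridGood x ρ (4*K))ᶜ := by
    intro ω hω
    by_contra hcon
    apply hω
    simp only [Set.mem_union, Set.mem_iUnion, Set.mem_compl_iff, not_or, not_exists, not_not,
      Set.mem_ofPred_eq, not_le, mem_Sinf_shift, add_zero] at hcon
    obtain ⟨hall, hgx⟩ := hcon
    have hcard : ∀ e, (3/4 : ℝ) * η * (L0 : ℝ) ^ d ≤ ({y | y ∈ box (cc e) n ∧ y ∈ Sinf ω}).ncard := by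
      intro e
      have e1 := (abs_lt.1 (hall e).1).1
      have e2 : (9/10 : ℝ) * (L0 : ℝ) ^ d ≤ (n : ℝ) ^ d := by
        have hLpos : (0 : ℝ) < L0 := by
          have : 0 < L0 := by omega
          exact_mod_cast this
        have hdR : (0 : ℝ) < d := by
          have : 0 < d := by omega
          exact_mod_cast this
        have hr : (8 * ρ : ℝ) ≤ L0 / (10 * d) := by
          rw [le_div_iff₀ (by positivity)]
          have : ((80 * d * ρ : ℕ) : ℝ) ≤ L0 := by exact_mod_cast hρK
          push_cast at this
          linarith
        have hnR : (n : ℝ) = L0 - 8 * ρ := by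
          have : ((n + 8 * ρ : ℕ) : ℝ) = L0 := by exact_mod_cast hn8
          push_cast at this
          linarith
        have hge : (L0 : ℝ) * (1 + -(1 / (10 * d))) ≤ n := by
          rw [hnR]
          have : (L0 : ℝ) * (1 + -(1 / (10 * d))) = L0 - L0 / (10 * d) := by ring
          linarith
        have hdiv : 1 / (10 * (d : ℝ)) ≤ 1 := by
          rw [div_le_one (by positivity)]
          have : (1 : ℝ) ≤ d := by
            have : 1 ≤ d := by omega
            exact_mod_cast this
          linarith
        have hb := one_add_mul_le_pow (a := -(1 / (10 * (d : ℝ)))) (by linarith) d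
        have hb' : (1 : ℝ) + d * -(1 / (10 * (d : ℝ))) = 9 / 10 := by
          field_simp
          norm_num
        rw [hb'] at hb
        calc (9/10 : ℝ) * (L0 : ℝ) ^ d ≤ (1 + -(1 / (10 * (d : ℝ)))) ^ d * (L0 : ℝ) ^ d :=
              mul_le_mul_of_nonneg_right hb (by positivity)
          _ = ((L0 : ℝ) * (1 + -(1 / (10 * d)))) ^ d := by rw [mul_pow, mul_comm]
          _ ≤ (n : ℝ) ^ d := pow_le_pow_left₀ (mul_nonneg hLpos.le (by linarith)) hge d
      have e3 : (96/100) * η * (n : ℝ) ^ d ≤ μ.real {ω | (0 : Pt d) ∈ Sinf ω} * (n : ℝ) ^ d :=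
        mul_le_mul_of_nonneg_right hμ.le (by positivity)
      have e4 : η * ((9/10 : ℝ) * (L0 : ℝ) ^ d) ≤ η * (n : ℝ) ^ d :=
        mul_le_mul_of_nonneg_left e2 hη.le
      have e5 : 0 ≤ η * (L0 : ℝ) ^ d := by positivity
      linarith
    have hne : ∀ e, ∃ w, w ∈ box (cc e) n ∧ w ∈ Sinf ω := by
      intro e
      by_contra hno
      have : {y | y ∈ box (cc e) n ∧ y ∈ Sinf ω} = ∅ := by
        ext y
        simp only [Set.mem_ofPred_eq, Set.mem_empty_iff_false, iff_false]
        exact fun h => hno ⟨y, h⟩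
      have h3 := hcard e
      rw [this] at h3
      have : (0 : ℝ) < (3/4 : ℝ) * η * (L0 : ℝ) ^ d := by
        have hLpos : (0 : ℝ) < L0 := by
          have : 0 < L0 := by omega
          exact_mod_cast this
        positivity
      simp at h3
      linarith
    choose w hwb hwi using hne
    have hin : ∀ e y, y ∈ box (cc e) n → ∀ i, subCorner x L0 e i + 4 * ρ ≤ y i ∧
        y i + 4 * ρ < subCorner x L0 e i + L0 := by
      intro e y hy i
      have := hy i
      simp only [cc] at this
      omega
    have hin2 : ∀ e y, y ∈ box (cc e) n → ∀ i, x i + 4 * ρ ≤ y i ∧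
        y i + 4 * ρ < x i + (2 * L0 : ℕ) := by
      intro e y hy i
      have := hin e y hy i
      unfold subCorner at this
      push_cast
      split_ifs at this <;> omega
    have hin3 : ∀ e y, y ∈ box (cc e) n → y ∈ box (subCorner x L0 e) L0 := by
      intro e y hy i
      have := hin e y hy i
      omega
    have hm1 : L0 ≤ 4 * K * ρ := by
      rw [mul_assoc]
      omega
    have hm2 : 2 * L0 ≤ 4 * K * ρ := by
      rw [mul_assoc]
      omega
    refine ⟨w, fun e => ⟨⟨Sinf_subset_Sr ω _ (hwi e), hin3 e _ (hwb e)⟩, (hcard e).trans ?_⟩, ?_⟩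
    · have hss : {y | y ∈ box (cc e) n ∧ y ∈ Sinf ω} ⊆
          cluster (Sr ω (L0 : ℝ) ∩ box (subCorner x L0 e) L0) (w e) := by
        rintro y ⟨hyb, hyi⟩
        exact connIn_Sr (Sinf_subset_Sr ω _ (hwi e)) (grid_connected (subCorner x L0 e) ρ (4*K) L0
          (by omega) hm1 ω (hall e).2 (w e) y (hwi e) hyi (hin e _ (hwb e)) (hin e _ hyb))
      exact_mod_cast Set.ncard_le_ncard hss
        (((box_finite _ _).subset Set.inter_subset_right).subset (cluster_subset _ _))
    · intro e e'
      exact grid_connected x ρ (4*K) (2*L0) (by omega) hm2 ω hgx (w e) (w e') (hwi e) (hwi e')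
        (hin2 e _ (hwb e)) (hin2 e' _ (hwb e'))
  refine (measureReal_mono hsub (measure_ne_top _ _)).trans ?_
  refine (measureReal_union_le _ _).trans ?_
  have hA : ∀ e : Fin d → Bool, μ.real ({ω | (6/100) * η * (n : ℝ) ^ d ≤
        |((({y | y ∈ box (cc e) n ∧ shift y ω ∈ {ω | (0 : Pt d) ∈ Sinf ω}}).ncard : ℝ))
          - μ.real {ω | (0 : Pt d) ∈ Sinf ω} * (n : ℝ) ^ d|} ∪ (gridGood (subCorner x L0 e) ρ (4*K))ᶜ)
        ≤ q / (3 * 2 ^ d) + q / (3 * 2 ^ d) := fun e =>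
    (measureReal_union_le _ _).trans (add_le_add (hN1 n hnN _) (hN2 ρ (by omega) _))
  have hB := hN2 ρ (by omega) x
  have hC := (measureReal_iUnion_fintype_le (μ := μ) (fun e : Fin d → Bool =>
    ({ω | (6/100) * η * (n : ℝ) ^ d ≤
        |((({y | y ∈ box (cc e) n ∧ shift y ω ∈ {ω | (0 : Pt d) ∈ Sinf ω}}).ncard : ℝ))
          - μ.real {ω | (0 : Pt d) ∈ Sinf ω} * (n : ℝ) ^ d|} ∪
      (gridGood (subCorner x L0 e) ρ (4*K))ᶜ))).trans (Finset.sum_le_sum fun e _ => hA e)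
  refine (add_le_add hC hB).trans ?_
  have hle : q / (3 * 2 ^ d) ≤ q / 3 := by
    apply div_le_div_of_nonneg_left hq.le (by norm_num)
    have : (1 : ℝ) ≤ 2 ^ d := one_le_pow₀ (by norm_num)
    linarith
  have hs : ∑ e : Fin d → Bool, (q / (3 * 2 ^ d) + q / (3 * 2 ^ d)) = 2 * q / 3 := by
    simp
    field_simp
    norm_num
  rw [hs]
  linarith

/-- Colourings of the leaves of the binary tree of depth `k`. -/
def Pat : ℕ → Type
  | 0 => Bool
  | k+1 => Pat k × Pat k

instance instFintypePat : (k : ℕ) → Fintype (Pat k)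
  | 0 => inferInstanceAs (Fintype Bool)
  | k+1 => @instFintypeProd (Pat k) (Pat k) (instFintypePat k) (instFintypePat k)

theorem card_Pat (k : ℕ) : Fintype.card (Pat k) = 2 ^ (2 ^ k) := by
  induction k with
  | zero => rfl
  | succ k ih =>
    have h := Fintype.card_prod (Pat k) (Pat k)
    rw [ih] at h
    rw [pow_succ 2 k, mul_two, pow_add]
    exact h

/-- The number of `true` leaves. -/
def Pat.cnt : (k : ℕ) → Pat k → ℕ
  | 0, t => if (show Bool from t) = true then 1 else 0
  | k+1, t => Pat.cnt k t.1 + Pat.cnt k t.2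

/-- The opposite colouring. -/
def Pat.neg : (k : ℕ) → Pat k → Pat k
  | 0, t => (!(show Bool from t) : Bool)
  | k+1, t => (Pat.neg k t.1, Pat.neg k t.2)

theorem Pat.cnt_add_neg (k : ℕ) (t : Pat k) : Pat.cnt k t + Pat.cnt k (Pat.neg k t) = 2 ^ k := by
  induction k with
  | zero =>
    change Bool at t
    cases t <;> rfl
  | succ k ih =>
    have h1 := ih t.1
    have h2 := ih t.2
    change Pat.cnt k t.1 + Pat.cnt k t.2 + (Pat.cnt k (Pat.neg k t.1) + Pat.cnt k (Pat.neg k t.2)) = _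
    rw [pow_succ]
    omega

/-- Cascading along a prescribed set of leaves. -/
def Ev (d : ℕ) (r0 l0 L0 θsc : ℕ) (seed : Pt d → Set (Config d)) :
    (k : ℕ) → Pat k → Pt d → Set (Config d)
  | 0, t, x => {ω | (show Bool from t) = true → ω ∈ seed x}
  | k+1, t, x => {ω | ∃ x₁ x₂ : Pt d,
      x₁ ∈ lattice d (LSc l0 L0 θsc k) ∩ box x (LSc l0 L0 θsc (k+1)) ∧
      x₂ ∈ lattice d (LSc l0 L0 θsc k) ∩ box x (LSc l0 L0 θsc (k+1)) ∧
      rSc r0 θsc k * LSc l0 L0 θsc k ≤ distInf x₁ x₂ ∧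
      ω ∈ Ev d r0 l0 L0 θsc seed k t.1 x₁ ∧ ω ∈ Ev d r0 l0 L0 θsc seed k t.2 x₂}

theorem cascade_mono (r0 l0 L0 θsc : ℕ) (s s' : Pt d → Set (Config d)) (h : ∀ x, s x ⊆ s' x)
    (k : ℕ) (x : Pt d) : cascade d r0 l0 L0 θsc s k x ⊆ cascade d r0 l0 L0 θsc s' k x := by
  induction k generalizing x with
  | zero => exact h x
  | succ k ih =>
    rintro ω ⟨x₁, x₂, h1, h2, h3, h4, h5⟩
    exact ⟨x₁, x₂, h1, h2, h3, ih x₁ h4, ih x₂ h5⟩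

theorem cascade_cover (r0 l0 L0 θsc : ℕ) (s D I : Pt d → Set (Config d))
    (h : ∀ x, s x ⊆ D x ∪ I x) (k : ℕ) (x : Pt d) :
    cascade d r0 l0 L0 θsc s k x ⊆ ⋃ t : Pat k, (Ev d r0 l0 L0 θsc D k t x ∩
      Ev d r0 l0 L0 θsc I k (Pat.neg k t) x) := by
  induction k generalizing x with
  | zero =>
    intro ω hω
    rcases h x hω with h1 | h1
    · refine Set.mem_iUnion.2 ⟨(true : Bool), fun _ => h1, fun hf => ?_⟩
      exact absurd hf (by decide)
    · refine Set.mem_iUnion.2 ⟨(false : Bool), fun hf => ?_, fun _ => h1⟩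
      exact absurd hf (by decide)
  | succ k ih =>
    rintro ω ⟨x₁, x₂, h1, h2, h3, h4, h5⟩
    obtain ⟨t1, ht1, ht1'⟩ := Set.mem_iUnion.1 (ih x₁ h4)
    obtain ⟨t2, ht2, ht2'⟩ := Set.mem_iUnion.1 (ih x₂ h5)
    exact Set.mem_iUnion.2 ⟨(t1, t2), ⟨x₁, x₂, h1, h2, h3, ht1, ht2⟩,
      ⟨x₁, x₂, h1, h2, h3, ht1', ht2'⟩⟩

theorem Ev_decreasing (r0 l0 L0 θsc : ℕ) (s : Pt d → Set (Config d))
    (h : ∀ x, DecreasingEvent (s x)) (k : ℕ) (t : Pat k) (x : Pt d) :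
    DecreasingEvent (Ev d r0 l0 L0 θsc s k t x) := by
  induction k generalizing x with
  | zero => exact fun ω ω' hw hω ht => h x ω ω' hw (hω ht)
  | succ k ih =>
    rintro ω ω' hw ⟨x₁, x₂, h1, h2, h3, h4, h5⟩
    exact ⟨x₁, x₂, h1, h2, h3, ih _ x₁ ω ω' hw h4, ih _ x₂ ω ω' hw h5⟩

theorem Ev_increasing (r0 l0 L0 θsc : ℕ) (s : Pt d → Set (Config d))
    (h : ∀ x, IncreasingEvent (s x)) (k : ℕ) (t : Pat k) (x : Pt d) :
    IncreasingEvent (Ev d r0 l0 L0 θsc s k t x) := by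
  induction k generalizing x with
  | zero => exact fun ω ω' hw hω ht => h x ω ω' hw (hω ht)
  | succ k ih =>
    rintro ω ω' hw ⟨x₁, x₂, h1, h2, h3, h4, h5⟩
    exact ⟨x₁, x₂, h1, h2, h3, ih _ x₁ ω ω' hw h4, ih _ x₂ ω ω' hw h5⟩

theorem Ev_dependsOn (r0 l0 L0 θsc : ℕ) (hl : 2 ≤ l0) (s : Pt d → Set (Config d))
    (h : ∀ x, DependsOn (s x) (ballZ x (10 * L0))) (k : ℕ) (t : Pat k) (x : Pt d) :
    DependsOn (Ev d r0 l0 L0 θsc s k t x) (ballZ x (10 * LSc l0 L0 θsc k)) := by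
  induction k generalizing x with
  | zero =>
    intro ω ω' hw
    have := h x ω ω' hw
    change (_ → _) ↔ (_ → _)
    rw [this]
  | succ k ih =>
    have hLL : 2 * LSc l0 L0 θsc k ≤ LSc l0 L0 θsc (k+1) := by
      change _ ≤ lSc l0 θsc k * LSc l0 L0 θsc k
      refine Nat.mul_le_mul_right _ (hl.trans ?_)
      unfold lSc
      exact Nat.le_mul_of_pos_right _ (by positivity)
    have hsub : ∀ y ∈ box x (LSc l0 L0 θsc (k+1)),
        ballZ y (10 * LSc l0 L0 θsc k) ⊆ ballZ x (10 * LSc l0 L0 θsc (k+1)) := by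
      intro y hy z hz
      rw [mem_ballZ_iff] at *
      intro i
      have h1 := hy i
      have h2 := hz i
      omega
    intro ω ω' hw
    have key : ∀ (t' : Pat k) y, y ∈ box x (LSc l0 L0 θsc (k+1)) →
        (ω ∈ Ev d r0 l0 L0 θsc s k t' y ↔ ω' ∈ Ev d r0 l0 L0 θsc s k t' y) := fun t' y hy =>
      ih t' y ω ω' fun z hz => hw z (hsub y hy hz)
    constructor
    · rintro ⟨x₁, x₂, h1, h2, h3, h4, h5⟩
      exact ⟨x₁, x₂, h1, h2, h3, (key _ _ h1.2).1 h4, (key _ _ h2.2).1 h5⟩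
    · rintro ⟨x₁, x₂, h1, h2, h3, h4, h5⟩
      exact ⟨x₁, x₂, h1, h2, h3, (key _ _ h1.2).2 h4, (key _ _ h2.2).2 h5⟩

/-- Counting lattice points in a box. -/
theorem lattice_box_count (L l : ℕ) (hL : 0 < L) (x : Pt d) :
    ∃ F : Finset (Pt d), (∀ y, y ∈ lattice d L ∩ box x (l * L) → y ∈ F) ∧ F.card ≤ l ^ d := by
  have hfin : (lattice d L ∩ box x (l * L)).Finite :=
    (box_finite x (l * L)).subset Set.inter_subset_right
  refine ⟨hfin.toFinset, fun y hy => hfin.mem_toFinset.2 hy, ?_⟩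
  have hLZ : (0 : ℤ) < L := by exact_mod_cast hL
  have : hfin.toFinset.card ≤ (Fintype.piFinset (fun _ : Fin d => Finset.range l)).card := by
    apply Finset.card_le_card_of_injOn (fun y i => ((y i - x i) / L).toNat)
    · intro y hy
      have hy' := (hfin.mem_toFinset.1 hy).2
      simp only [Finset.coe_sort_coe, Finset.mem_coe, Fintype.mem_piFinset, Finset.mem_range]
      intro i
      have h1 := hy' i
      have h2 : 0 ≤ (y i - x i) / L := Int.ediv_nonneg (by omega) hLZ.le
      have h3 : (y i - x i) / L < l := by
        rw [Int.ediv_lt_iff_lt_mul hLZ]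
        push_cast at h1
        linarith
      omega
    · intro y hy y' hy' heq
      have hy1 := hfin.mem_toFinset.1 hy
      have hy1' := hfin.mem_toFinset.1 hy'
      funext i
      have h0 := congrFun heq i
      simp only at h0
      have h1 := hy1.2 i
      have h1' := hy1'.2 i
      have h2 : 0 ≤ (y i - x i) / L := Int.ediv_nonneg (by omega) hLZ.le
      have h2' : 0 ≤ (y' i - x i) / L := Int.ediv_nonneg (by omega) hLZ.le
      have h3 : (y i - x i) / L = (y' i - x i) / L := by omega
      have h4 : (y i - x i) % L = (y' i - x i) % L := by
        rw [Int.sub_emod, Int.sub_emod (y' i), Int.emod_eq_zero_of_dvd (hy1.1 i),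
          Int.emod_eq_zero_of_dvd (hy1'.1 i)]
      have h5 := Int.mul_ediv_add_emod (y i - x i) L
      have h6 := Int.mul_ediv_add_emod (y' i - x i) L
      rw [h3, h4] at h5
      omega
  simpa using this

theorem LSc_pos (l0 L0 θsc : ℕ) (hl : 0 < l0) (hL : 0 < L0) (k : ℕ) : 0 < LSc l0 L0 θsc k := by
  induction k with
  | zero => exact hL
  | succ k ih =>
    change 0 < lSc l0 θsc k * LSc l0 L0 θsc k
    have : 0 < lSc l0 θsc k := by unfold lSc; positivity
    positivity

/-- Combinatorial cost at level `j`. -/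
noncomputable def cCost (d l0 θsc j : ℕ) : ℝ := Real.log 2 + 2 * d * Real.log (lSc l0 θsc j)

noncomputable def sCost (d l0 θsc k : ℕ) : ℝ :=
  ∑ j ∈ Finset.range k, cCost d l0 θsc j / 2 ^ (j + 1)

theorem cCost_nonneg (d l0 θsc j : ℕ) : 0 ≤ cCost d l0 θsc j := by
  unfold cCost
  have h1 : 0 ≤ Real.log 2 := Real.log_nonneg (by norm_num)
  have h2 := Real.log_natCast_nonneg (lSc l0 θsc j)
  positivity

theorem sCost_nonneg (d l0 θsc k : ℕ) : 0 ≤ sCost d l0 θsc k :=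
  Finset.sum_nonneg fun j _ => div_nonneg (cCost_nonneg _ _ _ _) (by positivity)

theorem Ev_bound (r0 l0 L0 θsc : ℕ) (hl : 0 < l0) (hL : 0 < L0) (s : Pt d → Set (Config d))
    (μ : ℕ → Measure (Config d)) (hμ : ∀ k, IsProbabilityMeasure (μ k)) (err : ℕ → ℝ) (q : ℝ)
    (hq0 : 0 ≤ q) (hq1 : q ≤ 1) (herr : ∀ k, err k ≤ q ^ (2 ^ (k+1)))
    (hseed : ∀ x, (μ 0).real (s x) ≤ q)
    (hstep : ∀ k (t₁ t₂ : Pat k) (x₁ x₂ : Pt d), rSc r0 θsc k * LSc l0 L0 θsc k ≤ distInf x₁ x₂ →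
      (μ (k+1)).real (Ev d r0 l0 L0 θsc s k t₁ x₁ ∩ Ev d r0 l0 L0 θsc s k t₂ x₂) ≤
        (μ k).real (Ev d r0 l0 L0 θsc s k t₁ x₁) * (μ k).real (Ev d r0 l0 L0 θsc s k t₂ x₂) + err k)
    (k : ℕ) (t : Pat k) (x : Pt d) :
    (μ k).real (Ev d r0 l0 L0 θsc s k t x) ≤
      Real.exp (2 ^ k * sCost d l0 θsc k) * q ^ (Pat.cnt k t) := by
  induction k generalizing x with
  | zero =>
    simp only [sCost, Finset.range_zero, Finset.sum_empty, mul_zero, Real.exp_zero, one_mul]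
    change Bool at t
    cases t with
    | false =>
      change _ ≤ q ^ 0
      rw [pow_zero]
      have := hμ 0
      exact measureReal_le_one
    | true =>
      change _ ≤ q ^ 1
      rw [pow_one]
      have he : Ev d r0 l0 L0 θsc s 0 (true : Bool) x = s x := by
        ext ω
        exact ⟨fun h => h rfl, fun h _ => h⟩
      rw [he]
      exact hseed x
  | succ k ih =>
    have := hμ (k+1)
    obtain ⟨F, hF, hFc⟩ := lattice_box_count (LSc l0 L0 θsc k) (lSc l0 θsc k)
      (LSc_pos l0 L0 θsc hl hL k) x
    obtain ⟨t1, t2⟩ := t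
    set E := Real.exp (2 ^ k * sCost d l0 θsc k) with hE
    have hE1 : 1 ≤ E := Real.one_le_exp (mul_nonneg (by positivity) (sCost_nonneg _ _ _ _))
    have hcnt : Pat.cnt k t1 + Pat.cnt k t2 ≤ 2 ^ (k+1) := by
      have h1 := Pat.cnt_add_neg k t1
      have h2 := Pat.cnt_add_neg k t2
      rw [pow_succ]
      omega
    classical
    let G : Pt d × Pt d → Set (Config d) := fun p =>
      if rSc r0 θsc k * LSc l0 L0 θsc k ≤ distInf p.1 p.2 then
        Ev d r0 l0 L0 θsc s k t1 p.1 ∩ Ev d r0 l0 L0 θsc s k t2 p.2 else ∅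
    have hsub : Ev d r0 l0 L0 θsc s (k+1) (t1, t2) x ⊆ ⋃ p ∈ F ×ˢ F, G p := by
      rintro ω ⟨x₁, x₂, h1, h2, h3, h4, h5⟩
      refine Set.mem_iUnion₂.2 ⟨(x₁, x₂), Finset.mem_product.2 ⟨hF x₁ h1, hF x₂ h2⟩, ?_⟩
      simp only [G, h3, if_true]
      exact ⟨h4, h5⟩
    have hG : ∀ p, (μ (k+1)).real (G p) ≤ 2 * E ^ 2 * q ^ (Pat.cnt k t1 + Pat.cnt k t2) := by
      intro p
      by_cases hp : rSc r0 θsc k * LSc l0 L0 θsc k ≤ distInf p.1 p.2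
      · simp only [G, hp, if_true]
        refine (hstep k t1 t2 p.1 p.2 hp).trans ?_
        have h1 := ih t1 p.1
        have h2 := ih t2 p.2
        have h3 := mul_le_mul h1 h2 measureReal_nonneg (by positivity)
        have h4 : err k ≤ q ^ (Pat.cnt k t1 + Pat.cnt k t2) :=
          (herr k).trans (pow_le_pow_of_le_one hq0 hq1 hcnt)
        have h5 : q ^ (Pat.cnt k t1 + Pat.cnt k t2) ≤ E ^ 2 * q ^ (Pat.cnt k t1 + Pat.cnt k t2) :=
          le_mul_of_one_le_left (by positivity) (one_le_pow₀ hE1)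
        have h6 : E * q ^ Pat.cnt k t1 * (E * q ^ Pat.cnt k t2) =
            E ^ 2 * q ^ (Pat.cnt k t1 + Pat.cnt k t2) := by rw [pow_add]; ring
        rw [h6] at h3
        linarith
      · simp only [G, hp, if_false, measureReal_empty]
        positivity
    have hfinal : (μ (k+1)).real (Ev d r0 l0 L0 θsc s (k+1) (t1, t2) x) ≤
        ((lSc l0 θsc k : ℝ) ^ d * (lSc l0 θsc k : ℝ) ^ d) *
          (2 * E ^ 2 * q ^ (Pat.cnt k t1 + Pat.cnt k t2)) := by
      refine (measureReal_mono hsub (measure_ne_top _ _)).trans ?_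
      refine (measureReal_biUnion_finset_le _ _).trans ?_
      refine (Finset.sum_le_sum fun p _ => hG p).trans ?_
      rw [Finset.sum_const, nsmul_eq_mul, Finset.card_product]
      apply mul_le_mul_of_nonneg_right _ (by positivity)
      have : (F.card : ℝ) ≤ (lSc l0 θsc k : ℝ) ^ d := by exact_mod_cast hFc
      push_cast
      exact mul_le_mul this this (by positivity) (by positivity)
    refine hfinal.trans (le_of_eq ?_)
    change _ = _ * q ^ (Pat.cnt k t1 + Pat.cnt k t2)
    have hlpos : (0 : ℝ) < lSc l0 θsc k := by
      have : 0 < lSc l0 θsc k := by unfold lSc; positivity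
      exact_mod_cast this
    have hexp : Real.exp (2 ^ (k+1) * sCost d l0 θsc (k+1)) =
        E ^ 2 * (2 * ((lSc l0 θsc k : ℝ) ^ d * (lSc l0 θsc k : ℝ) ^ d)) := by
      have e1 : 2 ^ (k+1) * sCost d l0 θsc (k+1) =
          2 ^ k * sCost d l0 θsc k + 2 ^ k * sCost d l0 θsc k + (Real.log 2 +
            (d * Real.log (lSc l0 θsc k) + d * Real.log (lSc l0 θsc k))) := by
        have : sCost d l0 θsc (k+1) = sCost d l0 θsc k + cCost d l0 θsc k / 2 ^ (k+1) := by
          unfold sCost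
          rw [Finset.sum_range_succ]
        rw [this, mul_add, mul_div_cancel₀ _ (by positivity)]
        unfold cCost
        ring
      rw [e1, Real.exp_add, Real.exp_add, Real.exp_add, Real.exp_add, Real.exp_log (by norm_num),
        Real.exp_nat_mul, Real.exp_log hlpos, ← hE]
      ring
    rw [hexp]
    ring

theorem sCost_bounded (d l0 θsc : ℕ) (hl : 0 < l0) : ∃ S : ℝ, ∀ k, sCost d l0 θsc k ≤ S := by
  have hsum : Summable fun j : ℕ => cCost d l0 θsc j / 2 ^ (j + 1) := by
    have h1 : Summable fun j : ℕ => ((1 : ℝ) / 2) ^ j := summable_geometric_of_lt_one (by norm_num) (by norm_num)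
    have h2 : Summable fun j : ℕ => (j : ℝ) ^ θsc * ((1 : ℝ) / 2) ^ j :=
      summable_pow_mul_geometric_of_norm_lt_one θsc (by norm_num)
    have h3 := (h1.mul_left ((Real.log 2 + 2 * d * Real.log l0) / 2)).add
      (h2.mul_left (2 * d * Real.log 4 / 2))
    refine h3.congr fun j => ?_
    unfold cCost lSc
    push_cast
    rw [Real.log_mul (by positivity) (by positivity), Real.log_pow]
    push_cast
    rw [pow_succ, one_div, inv_pow]
    field_simp
    try ring
  exact ⟨_, fun k => hsum.sum_le_tsum _ fun j _ => div_nonneg (cCost_nonneg _ _ _ _) (by positivity)⟩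

/-- The cumulative sprinkling factor. -/
noncomputable def lvl (r0 θsc : ℕ) (χ : ℝ) (k : ℕ) : ℝ :=
  ∏ j ∈ Finset.range k, (1 + (rSc r0 θsc j : ℝ) ^ (-χ))

theorem lvl_zero (r0 θsc : ℕ) (χ : ℝ) : lvl r0 θsc χ 0 = 1 := by simp [lvl]

theorem lvl_succ (r0 θsc : ℕ) (χ : ℝ) (k : ℕ) :
    lvl r0 θsc χ (k+1) = lvl r0 θsc χ k * (1 + (rSc r0 θsc k : ℝ) ^ (-χ)) := by
  simp [lvl, Finset.prod_range_succ]

theorem rSc_pos (r0 θsc k : ℕ) (hr : 0 < r0) : 0 < rSc r0 θsc k := by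
  unfold rSc; positivity

theorem le_rSc (r0 θsc k : ℕ) : r0 ≤ rSc r0 θsc k := by
  unfold rSc
  exact Nat.le_mul_of_pos_right _ (by positivity)

theorem one_le_lvl (r0 θsc : ℕ) (χ : ℝ) (k : ℕ) : 1 ≤ lvl r0 θsc χ k := by
  induction k with
  | zero => rw [lvl_zero]
  | succ k ih =>
    rw [lvl_succ]
    have : (0:ℝ) ≤ (rSc r0 θsc k : ℝ) ^ (-χ) := by positivity
    nlinarith

theorem exists_level (τ χ : ℝ) (hτ : 1 < τ) (hχ : 0 < χ) (θsc : ℕ) (hθ : 1 ≤ θsc) :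
    ∃ C : ℕ, ∀ r0 : ℕ, C ≤ r0 → ∀ k, lvl r0 θsc χ k ≤ τ := by
  set ρ : ℝ := (2:ℝ) ^ (-χ) with hρ
  have hρ0 : 0 < ρ := by positivity
  have hρ1 : ρ < 1 := Real.rpow_lt_one_of_one_lt_of_neg (by norm_num) (by linarith)
  have hlog : 0 < Real.log τ := Real.log_pos hτ
  have ht : Tendsto (fun r : ℕ => (r:ℝ) ^ (-χ)) atTop (nhds 0) :=
    (tendsto_rpow_neg_atTop hχ).comp tendsto_natCast_atTop_atTop
  have h1 : 0 < Real.log τ * (1 - ρ) := mul_pos hlog (by linarith)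
  obtain ⟨N, hN⟩ := eventually_atTop.1 (ht.eventually (gt_mem_nhds h1))
  refine ⟨max N 1, fun r0 hr k => ?_⟩
  have hrN := hN r0 ((le_max_left _ _).trans hr)
  have hr1 : 1 ≤ r0 := (le_max_right _ _).trans hr
  have hr0 : (0:ℝ) < r0 := by exact_mod_cast hr1
  have ha : ∀ j, (rSc r0 θsc j : ℝ) ^ (-χ) ≤ (r0:ℝ) ^ (-χ) * ρ ^ j := by
    intro j
    have h2 : (r0:ℝ) * 2 ^ j ≤ (rSc r0 θsc j : ℝ) := by
      unfold rSc
      push_cast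
      have : j ≤ j ^ θsc := Nat.le_self_pow (by omega) j
      gcongr
      norm_num
    calc (rSc r0 θsc j : ℝ) ^ (-χ) ≤ ((r0:ℝ) * 2 ^ j) ^ (-χ) :=
          Real.rpow_le_rpow_of_nonpos (by positivity) h2 (by linarith)
      _ = (r0:ℝ) ^ (-χ) * ρ ^ j := by
          rw [Real.mul_rpow (by positivity) (by positivity), hρ, ← Real.rpow_natCast,
            ← Real.rpow_natCast, ← Real.rpow_mul (by norm_num), ← Real.rpow_mul (by norm_num),
            mul_comm (j:ℝ)]
  have hgeo : ∑ j ∈ Finset.range k, ρ ^ j ≤ 1 / (1 - ρ) := by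
    have := (summable_geometric_of_lt_one hρ0.le hρ1).sum_le_tsum (Finset.range k)
      (fun j _ => by positivity)
    rwa [tsum_geometric_of_lt_one hρ0.le hρ1, ← one_div] at this
  calc lvl r0 θsc χ k ≤ ∏ j ∈ Finset.range k, Real.exp ((r0:ℝ) ^ (-χ) * ρ ^ j) := by
        unfold lvl
        refine Finset.prod_le_prod (fun j _ => by positivity) fun j _ => ?_
        have := Real.add_one_le_exp ((r0:ℝ) ^ (-χ) * ρ ^ j)
        linarith [ha j]
    _ = Real.exp ((r0:ℝ) ^ (-χ) * ∑ j ∈ Finset.range k, ρ ^ j) := by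
        rw [← Real.exp_sum, Finset.mul_sum]
    _ ≤ Real.exp (Real.log τ) := by
        apply Real.exp_le_exp.2
        calc (r0:ℝ) ^ (-χ) * ∑ j ∈ Finset.range k, ρ ^ j ≤ (Real.log τ * (1 - ρ)) * (1 / (1 - ρ)) := by
              gcongr
          _ = Real.log τ := by
              have : (1 - ρ) ≠ 0 := by linarith
              field_simp
    _ = τ := Real.exp_log (by linarith)

theorem L0_le_LSc (l0 L0 θsc : ℕ) (hl : 0 < l0) (k : ℕ) : L0 ≤ LSc l0 L0 θsc k := by
  induction k with
  | zero => exact le_rfl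
  | succ k ih =>
    refine ih.trans ?_
    change _ ≤ lSc l0 θsc k * LSc l0 L0 θsc k
    exact Nat.le_mul_of_pos_left _ (by unfold lSc; positivity)

theorem four_pow_le_LSc (l0 L0 θsc : ℕ) (hl : 0 < l0) (hL : 0 < L0) (m : ℕ) :
    4 ^ (m ^ θsc) ≤ LSc l0 L0 θsc (m+1) := by
  change _ ≤ lSc l0 θsc m * LSc l0 L0 θsc m
  have h1 := LSc_pos l0 L0 θsc hl hL m
  unfold lSc
  calc 4 ^ (m ^ θsc) = 1 * 4 ^ (m ^ θsc) * 1 := by ring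
    _ ≤ l0 * 4 ^ (m ^ θsc) * LSc l0 L0 θsc m := by gcongr <;> omega

theorem exists_error (ε : ℝ) (hε : 0 < ε) (LP : ℕ) (fP : ℕ → ℝ)
    (hf : ∀ L : ℕ, LP ≤ L → Real.exp ((Real.log L) ^ ε) ≤ fP L) (q : ℝ) (hq0 : 0 < q)
    (hq1 : q < 1) :
    ∃ N : ℕ, ∀ L0 : ℕ, N ≤ L0 → ∀ l0 : ℕ, 0 < l0 → ∀ k,
      Real.exp (-(fP (LSc l0 L0 ⌈1/ε⌉₊ k))) ≤ q ^ (2 ^ (k+1)) := by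
  set θ := ⌈1/ε⌉₊ with hθ
  have hθε : 1 ≤ (θ:ℝ) * ε := by
    have : 1/ε ≤ (θ:ℝ) := Nat.le_ceil _
    rwa [div_le_iff₀ hε] at this
  have hlq : 0 < -Real.log q := by linarith [Real.log_neg hq0 hq1]
  set lam := -Real.log q with hlam
  set Q := |Real.log lam| with hQ
  have hQ0 : 0 ≤ Q := abs_nonneg _
  have hQl : Real.log lam ≤ Q := le_abs_self _
  have ht : Tendsto (fun n : ℕ => (Real.log (n:ℝ)) ^ ε) atTop atTop :=
    (tendsto_rpow_atTop hε).comp (Real.tendsto_log_atTop.comp tendsto_natCast_atTop_atTop)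
  obtain ⟨N, hN⟩ := eventually_atTop.1 (ht.eventually (eventually_ge_atTop (5*(Q+1))))
  refine ⟨max (max N LP) 1, fun L0 hL l0 hl k => ?_⟩
  have hL1 : 1 ≤ L0 := (le_max_right _ _).trans hL
  have hLN : N ≤ L0 := ((le_max_left _ _).trans (le_max_left _ _)).trans hL
  have hLP : LP ≤ L0 := ((le_max_right _ _).trans (le_max_left _ _)).trans hL
  have hLk := L0_le_LSc l0 L0 θ hl k
  have hb1 : 5*(Q+1) ≤ (Real.log (LSc l0 L0 θ k)) ^ ε := hN _ (hLN.trans hLk)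
  have hl2 : Real.log 2 < 0.7 := by linarith [Real.log_two_lt_d9]
  have hl2' : 0.6 < Real.log 2 := by linarith [Real.log_two_gt_d9]
  have key : ((k:ℝ)+1) * Real.log 2 + Real.log lam ≤ (Real.log (LSc l0 L0 θ k)) ^ ε := by
    have h7 : ((k:ℝ)+1) * Real.log 2 ≤ ((k:ℝ)+1) * 0.7 := by gcongr
    cases k with
    | zero => push_cast at h7 ⊢; linarith
    | succ m =>
      have hb2 : (m:ℝ) ≤ (Real.log (LSc l0 L0 θ (m+1))) ^ ε := by
        rcases Nat.eq_zero_or_pos m with rfl | hm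
        · push_cast; linarith
        have hm1 : (1:ℝ) ≤ m := by exact_mod_cast hm
        have h4 : ((4:ℝ) ^ (m ^ θ)) ≤ LSc l0 L0 θ (m+1) := by
          exact_mod_cast four_pow_le_LSc l0 L0 θ hl hL1 m
        have h5 : (m:ℝ) ^ θ ≤ Real.log (LSc l0 L0 θ (m+1)) := by
          have h6 := Real.log_le_log (by positivity) h4
          rw [Real.log_pow] at h6
          have h8 : 1 ≤ Real.log 4 := by
            have : (4:ℝ) = 2 * 2 := by norm_num
            rw [this, Real.log_mul (by norm_num) (by norm_num)]
            linarith
          push_cast at h6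
          have h9 : (0:ℝ) ≤ (m:ℝ) ^ θ := by positivity
          nlinarith
        calc (m:ℝ) = (m:ℝ) ^ (1:ℝ) := (Real.rpow_one _).symm
          _ ≤ (m:ℝ) ^ ((θ:ℝ) * ε) := Real.rpow_le_rpow_of_exponent_le hm1 hθε
          _ = ((m:ℝ) ^ θ) ^ ε := by rw [Real.rpow_mul (by positivity), Real.rpow_natCast]
          _ ≤ _ := Real.rpow_le_rpow (by positivity) h5 hε.le
      push_cast at h7 ⊢
      by_cases hc : 1.4 + Q ≤ 0.3 * (m:ℝ)
      · linarith
      · push Not at hc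
        linarith
  have hfl := hf _ (hLP.trans hLk)
  have h10 : lam * 2 ^ (k+1) ≤ fP (LSc l0 L0 θ k) := by
    refine le_trans ?_ ((Real.exp_le_exp.2 key).trans hfl)
    rw [Real.exp_add, Real.exp_log hlq]
    have : ((k:ℝ)+1) * Real.log 2 = ((k+1:ℕ):ℝ) * Real.log 2 := by push_cast; ring
    rw [this, Real.exp_nat_mul, Real.exp_log (by norm_num), mul_comm]
  calc Real.exp (-(fP (LSc l0 L0 θ k))) ≤ Real.exp (((2 ^ (k+1) : ℕ):ℝ) * Real.log q) := by
        apply Real.exp_le_exp.2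
        push_cast
        have : lam * 2 ^ (k+1) = -(2 ^ (k+1) * Real.log q) := by rw [hlam]; ring
        linarith
    _ = q ^ (2 ^ (k+1)) := by rw [Real.exp_nat_mul, Real.exp_log hq0]

theorem tendsto_exp_fS (Δ : ℝ) (hΔ : 0 < Δ) (f : ℕ → ℝ) (R0 : ℕ)
    (hf : ∀ R : ℕ, R0 ≤ R → (Real.log R) ^ (1 + Δ) ≤ f R) :
    Tendsto (fun R => Real.exp (-(f R))) atTop (nhds 0) := by
  have ht : Tendsto (fun n : ℕ => (Real.log (n:ℝ)) ^ (1 + Δ)) atTop atTop :=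
    (tendsto_rpow_atTop (by linarith)).comp
      (Real.tendsto_log_atTop.comp tendsto_natCast_atTop_atTop)
  have h2 : Tendsto f atTop atTop :=
    tendsto_atTop_mono' _ (eventually_atTop.2 ⟨R0, hf⟩) ht
  exact Real.tendsto_exp_neg_atTop_nhds_zero.comp h2

/-- Summation over patterns. -/
theorem pattern_sum (μ : Measure (Config d)) [IsProbabilityMeasure μ] (r0 l0 L0 θsc : ℕ)
    (s D I : Pt d → Set (Config d)) (h : ∀ x, s x ⊆ D x ∪ I x) (S : ℝ) (k : ℕ) (x : Pt d)
    (hS : sCost d l0 θsc k ≤ S)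
    (hD : ∀ t : Pat k, μ.real (Ev d r0 l0 L0 θsc D k t x) ≤
      Real.exp (2 ^ k * sCost d l0 θsc k) * ((Real.exp (-S) / 4) ^ 2) ^ (Pat.cnt k t))
    (hI : ∀ t : Pat k, μ.real (Ev d r0 l0 L0 θsc I k t x) ≤
      Real.exp (2 ^ k * sCost d l0 θsc k) * ((Real.exp (-S) / 4) ^ 2) ^ (Pat.cnt k t)) :
    μ.real (cascade d r0 l0 L0 θsc s k x) ≤ (2⁻¹ : ℝ) ^ (2 ^ k) := by
  have hS0 : 0 ≤ S := (sCost_nonneg d l0 θsc k).trans hS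
  set σ := Real.exp (-S) / 4 with hσ
  have hσ0 : 0 < σ := by positivity
  have hσ1 : σ ≤ 1 := by
    have : Real.exp (-S) ≤ 1 := Real.exp_le_one_iff.2 (by linarith)
    rw [hσ]; linarith
  have hE : Real.exp (2 ^ k * sCost d l0 θsc k) ≤ Real.exp S ^ (2 ^ k) := by
    rw [← Real.exp_nat_mul]
    push_cast
    gcongr
  have hfin : Real.exp S ^ (2^k) * σ ^ (2^k) = (4⁻¹ : ℝ) ^ (2 ^ k) := by
    rw [← mul_pow, hσ]
    congr 1
    rw [← mul_div_assoc, ← Real.exp_add]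
    norm_num
  have hone : ∀ n : ℕ, 2 ^ k ≤ 2 * n →
      Real.exp (2 ^ k * sCost d l0 θsc k) * (σ ^ 2) ^ n ≤ (4⁻¹ : ℝ) ^ (2 ^ k) := by
    intro n hn
    rw [← hfin, ← pow_mul]
    exact mul_le_mul hE (pow_le_pow_of_le_one hσ0.le hσ1 hn) (by positivity) (by positivity)
  have ht : ∀ t : Pat k, μ.real (Ev d r0 l0 L0 θsc D k t x ∩
      Ev d r0 l0 L0 θsc I k (Pat.neg k t) x) ≤ (4⁻¹ : ℝ) ^ (2 ^ k) := by
    intro t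
    have hc := Pat.cnt_add_neg k t
    rcases le_total (Pat.cnt k t) (Pat.cnt k (Pat.neg k t)) with h1 | h1
    · exact (measureReal_mono Set.inter_subset_right).trans ((hI _).trans (hone _ (by omega)))
    · exact (measureReal_mono Set.inter_subset_left).trans ((hD _).trans (hone _ (by omega)))
  calc μ.real (cascade d r0 l0 L0 θsc s k x)
      ≤ μ.real (⋃ t : Pat k, (Ev d r0 l0 L0 θsc D k t x ∩
          Ev d r0 l0 L0 θsc I k (Pat.neg k t) x)) :=
        measureReal_mono (cascade_cover r0 l0 L0 θsc s D I h k x)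
    _ ≤ ∑ t : Pat k, μ.real (Ev d r0 l0 L0 θsc D k t x ∩
          Ev d r0 l0 L0 θsc I k (Pat.neg k t) x) := measureReal_iUnion_fintype_le _
    _ ≤ ∑ _t : Pat k, (4⁻¹ : ℝ) ^ (2 ^ k) := Finset.sum_le_sum fun t _ => ht t
    _ = (2⁻¹ : ℝ) ^ (2 ^ k) := by
        rw [Finset.sum_const, Finset.card_univ, card_Pat, nsmul_eq_mul]
        push_cast
        rw [← mul_pow]
        norm_num

/-- Lemma 2.5 / DRS Lemmas 4.2, 4.4. Under P1–P3 and S1–S2, with the scales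
`l_k, r_k, L_k` and `θ_sc = ⌈1/ε_P⌉`: for each `u ∈ (a,b)` there are `C = C(u)` and
`C' = C'(u,l_0)` such that for all `l_0, r_0 ≥ C`, `L_0 ≥ C'(l_0)` and all `k ≥ 0`,
`P^u[0 is k-bad] ≤ 2·2^{−2^k}`. -/
theorem stmt3 (d : ℕ) (hd : 2 ≤ d) (a b : ℝ) (ha : 0 ≤ a) (hab : a < b)
    (P : ℝ → Measure (Config d)) (Ax : Axioms d a b P) :
    ∀ u ∈ Set.Ioo a b,
      ∃ C : ℕ, ∃ C' : ℕ → ℕ,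
        ∀ l0 r0 L0 : ℕ, C ≤ l0 → C ≤ r0 → C' l0 ≤ L0 →
          ∀ k : ℕ,
            (P u (kBad d (eta d (P u)) r0 l0 L0 ⌈1/Ax.εP⌉₊ k (0 : Pt d))).toReal ≤
              2 * (2⁻¹ : ℝ) ^ (2 ^ k) := by
  intro u hu
  set θ := ⌈1/Ax.εP⌉₊ with hθdef
  have hθ : 1 ≤ θ := Nat.ceil_pos.2 (one_div_pos.2 Ax.εP_pos)
  set η := eta d (P u) with hηdef
  have hη : 0 < η := Ax.S2pos u hu
  have hu0 : 0 < u := lt_of_le_of_lt ha hu.1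
  -- choice of the auxiliary levels
  have hnh : Set.Ioo a b ∈ nhds u := isOpen_Ioo.mem_nhds hu
  have hcont : ContinuousAt (fun u => eta d (P u)) u := Ax.S2cont.continuousAt hnh
  have hev : ∀ᶠ v in nhds u, v ∈ Set.Ioo a b ∧ (96/100) * η < eta d (P v) ∧
      eta d (P v) < (11/10) * η := by
    refine (eventually_of_mem hnh fun v hv => hv).and ((hcont.eventually (lt_mem_nhds ?_)).and
      (hcont.eventually (gt_mem_nhds ?_)))
    · change _ < η; linarith
    · change η < _; linarith
  obtain ⟨δ, hδ, hball⟩ := Metric.eventually_nhds_iff.1 hev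
  obtain ⟨hv, hvη, -⟩ := hball (y := u - δ/2) (by
    rw [Real.dist_eq, abs_lt]; constructor <;> linarith)
  obtain ⟨hw, -, hwη⟩ := hball (y := u + δ/2) (by
    rw [Real.dist_eq, abs_lt]; constructor <;> linarith)
  set v := u - δ/2 with hvdef
  set w := u + δ/2 with hwdef
  have hvu : v < u := by linarith
  have huw : u < w := by linarith
  have hv0 : 0 < v := lt_of_le_of_lt ha hv.1
  have hw0 : 0 < w := hu0.trans huw
  obtain ⟨τ, hτ1, hτv, hτw⟩ : ∃ τ : ℝ, 1 < τ ∧ v * τ ≤ u ∧ u * τ ≤ w := by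
    refine ⟨min (u/v) (w/u), lt_min ((one_lt_div hv0).2 hvu) ((one_lt_div hu0).2 huw), ?_, ?_⟩
    · calc v * min (u/v) (w/u) ≤ v * (u/v) := by gcongr; exact min_le_left _ _
        _ = u := by field_simp
    · calc u * min (u/v) (w/u) ≤ u * (w/u) := by gcongr; exact min_le_right _ _
        _ = w := by field_simp
  obtain ⟨C1, hC1⟩ := exists_level τ Ax.χP hτ1 Ax.χP_pos θ hθ
  -- constants depending on `l0`
  have hC' : ∀ l0 : ℕ, ∃ N : ℕ, ∃ S : ℝ, 0 < l0 → (∀ k, sCost d l0 θ k ≤ S) ∧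
      0 < N ∧ ∀ L0 : ℕ, N ≤ L0 →
        (∀ x : Pt d, (P v).real (goodA d η L0 x)ᶜ ≤ (Real.exp (-S) / 4) ^ 2) ∧
        (∀ x : Pt d, (P w).real (eventB d η L0 x)ᶜ ≤ (Real.exp (-S) / 4) ^ 2) ∧
        (∀ k, Real.exp (-(Ax.fP (LSc l0 L0 θ k))) ≤ ((Real.exp (-S) / 4) ^ 2) ^ (2 ^ (k+1))) := by
    intro l0
    by_cases hl : 0 < l0
    swap
    · exact ⟨0, 0, fun h => absurd h hl⟩
    obtain ⟨S, hS⟩ := sCost_bounded d l0 θ hl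
    have hS0 : 0 ≤ S := (sCost_nonneg d l0 θ 0).trans (hS 0)
    have hq0 : 0 < (Real.exp (-S) / 4) ^ 2 := by positivity
    have hq1 : (Real.exp (-S) / 4) ^ 2 < 1 := by
      have h1 : Real.exp (-S) ≤ 1 := Real.exp_le_one_iff.2 (by linarith)
      have h2 : 0 < Real.exp (-S) := Real.exp_pos _
      nlinarith
    have := Ax.prob v hv
    have := Ax.prob w hw
    obtain ⟨N1, hN1⟩ := seedA hd (P v) (Ax.ergodic v hv) (fun R => Real.exp (-(Ax.fS v R)))
      (tendsto_exp_fS (Ax.ΔS v) (Ax.ΔS_pos v hv) (Ax.fS v) (Ax.RS v) (Ax.fS_lb v hv))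
      (Ax.S1a v hv) (Ax.S1b v hv) η hη hvη _ hq0
    obtain ⟨N2, hN2⟩ := seedB hd (P w) (Ax.ergodic w hw) η hη hwη _ hq0
    obtain ⟨N3, hN3⟩ := exists_error Ax.εP Ax.εP_pos Ax.LP Ax.fP Ax.fP_lb _ hq0 hq1
    refine ⟨N1 + N2 + N3 + 1, S, fun _ => ⟨hS, by omega, fun L0 hL => ⟨?_, ?_, ?_⟩⟩⟩
    · exact hN1 L0 (by omega)
    · exact hN2 L0 (by omega)
    · exact hN3 L0 (by omega) l0 hl
  choose N S hNS using hC'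
  refine ⟨C1 + Ax.RP + 2, N, fun l0 r0 L0 hl0 hr0 hL0 k => ?_⟩
  have hl2 : 2 ≤ l0 := by omega
  have hl : 0 < l0 := by omega
  have hr : 0 < r0 := by omega
  obtain ⟨hS, hN0, hN⟩ := hNS l0 hl
  obtain ⟨hsA, hsB, herr⟩ := hN L0 hL0
  have hL : 0 < L0 := by omega
  set q := (Real.exp (-(S l0)) / 4) ^ 2 with hq
  have hS0 : 0 ≤ S l0 := (sCost_nonneg d l0 θ 0).trans (hS 0)
  have hq0 : 0 ≤ q := by positivity
  have hq1 : q ≤ 1 := by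
    have h1 : Real.exp (-(S l0)) ≤ 1 := Real.exp_le_one_iff.2 (by linarith)
    have h2 : 0 < Real.exp (-(S l0)) := Real.exp_pos _
    rw [hq]
    nlinarith
  -- levels
  set A : ℕ → ℝ := lvl r0 θ Ax.χP with hA
  have hA1 : ∀ k, 1 ≤ A k := one_le_lvl r0 θ Ax.χP
  have hAτ : ∀ k, A k ≤ τ := hC1 r0 (by omega)
  have hAs : ∀ k, A (k+1) = A k * (1 + (rSc r0 θ k : ℝ) ^ (-Ax.χP)) := lvl_succ r0 θ Ax.χP
  have hrp : ∀ k, 0 < (rSc r0 θ k : ℝ) ^ (-Ax.χP) := fun k => by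
    have : (0:ℝ) < rSc r0 θ k := by exact_mod_cast rSc_pos r0 θ k hr
    positivity
  have hApos : ∀ k, 0 < A k := fun k => by linarith [hA1 k]
  have hAlt : ∀ k, A k < A (k+1) := fun k => by
    rw [hAs]; nlinarith [mul_pos (hApos k) (hrp k)]
  have hvk1 : ∀ k, v * A k ≤ u := fun k => le_trans (by gcongr; exact hAτ k) hτv
  have hvk : ∀ k, v * A k ∈ Set.Ioo a b := fun k =>
    ⟨lt_of_lt_of_le hv.1 (le_mul_of_one_le_right hv0.le (hA1 k)), lt_of_le_of_lt (hvk1 k) hu.2⟩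
  have hwk1 : ∀ k, u ≤ w / A k := fun k => by
    rw [le_div_iff₀ (hApos k)]
    exact le_trans (by gcongr; exact hAτ k) hτw
  have hwk : ∀ k, w / A k ∈ Set.Ioo a b := fun k =>
    ⟨lt_of_lt_of_le hu.1 (hwk1 k), lt_of_le_of_lt (div_le_self hw0.le (hA1 k)) hw.2⟩
  -- the seeds
  set D : Pt d → Set (Config d) := fun x => (goodA d η L0 x)ᶜ with hD
  set I : Pt d → Set (Config d) := fun x => (eventB d η L0 x)ᶜ with hI
  have hDdec : ∀ x, DecreasingEvent (D x) := fun x => goodA_compl_decreasing η L0 x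
  have hIinc : ∀ x, IncreasingEvent (I x) := fun x => eventB_compl_increasing η L0 x
  have hDdep : ∀ x, DependsOn (D x) (ballZ x (10 * L0)) := fun x =>
    dependsOn_compl (goodA_dependsOn η L0 x)
  have hIdep : ∀ x, DependsOn (I x) (ballZ x (10 * L0)) := fun x =>
    dependsOn_compl (eventB_dependsOn η L0 x)
  have hDm : ∀ k (t : Pat k) x, MeasurableSet (Ev d r0 l0 L0 θ D k t x) := fun k t x =>
    measurableSet_of_dependsOn (ballZ_finite _ _) (Ev_dependsOn r0 l0 L0 θ hl2 D hDdep k t x)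
  have hIm : ∀ k (t : Pat k) x, MeasurableSet (Ev d r0 l0 L0 θ I k t x) := fun k t x =>
    measurableSet_of_dependsOn (ballZ_finite _ _) (Ev_dependsOn r0 l0 L0 θ hl2 I hIdep k t x)
  have hRP : ∀ k, Ax.RP ≤ rSc r0 θ k := fun k => le_trans (by omega) (le_rSc r0 θ k)
  have hLpos : ∀ k, 1 ≤ LSc l0 L0 θ k := fun k => LSc_pos l0 L0 θ hl hL k
  have hpu := Ax.prob u hu
  -- bounds for decreasing events
  have hbD : ∀ t : Pat k, (P u).real (Ev d r0 l0 L0 θ D k t 0) ≤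
      Real.exp (2 ^ k * sCost d l0 θ k) * q ^ (Pat.cnt k t) := by
    intro t
    have h1 := Ev_bound r0 l0 L0 θ hl hL D (fun k => P (v * A k)) (fun k => Ax.prob _ (hvk k))
      (fun k => Real.exp (-(Ax.fP (LSc l0 L0 θ k)))) q hq0 hq1 herr
      (by
        intro x
        have : v * A 0 = v := by rw [hA, lvl_zero, mul_one]
        change (P (v * A 0)).real _ ≤ q
        rw [this]
        exact hsA x)
      (by
        intro k t₁ t₂ x₁ x₂ hx
        refine Ax.decoupleDec (rSc r0 θ k) (LSc l0 L0 θ k) (hRP k) (hLpos k) x₁ x₂ hx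
          (v * A (k+1)) (v * A k) (hvk k) (hvk (k+1)) (by gcongr; exact hAlt k) ?_ _ _
          (hDm k t₁ x₁) (hDm k t₂ x₂) (Ev_decreasing r0 l0 L0 θ D hDdec k t₁ x₁)
          (Ev_decreasing r0 l0 L0 θ D hDdec k t₂ x₂)
          (Ev_dependsOn r0 l0 L0 θ hl2 D hDdep k t₁ x₁)
          (Ev_dependsOn r0 l0 L0 θ hl2 D hDdep k t₂ x₂)
        rw [hAs]
        apply le_of_eq
        ring)
      k t 0
    refine le_trans ?_ h1
    have := Ax.prob _ (hvk k)
    have hinc : IncreasingEvent (Ev d r0 l0 L0 θ D k t 0)ᶜ := by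
      intro ω ω' hω h2 h3
      exact h2 (Ev_decreasing r0 l0 L0 θ D hDdec k t 0 ω' ω hω h3)
    have hm := Ax.mono (v * A k) (hvk k) u hu (hvk1 k) _ (hDm k t 0).compl hinc
    have hm2 : (P (v * A k)).real (Ev d r0 l0 L0 θ D k t 0)ᶜ ≤
        (P u).real (Ev d r0 l0 L0 θ D k t 0)ᶜ :=
      ENNReal.toReal_mono (measure_ne_top _ _) hm
    rw [probReal_compl_eq_one_sub (hDm k t 0), probReal_compl_eq_one_sub (hDm k t 0)] at hm2
    change _ ≤ (P (v * A k)).real _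
    linarith
  -- bounds for increasing events
  have hbI : ∀ t : Pat k, (P u).real (Ev d r0 l0 L0 θ I k t 0) ≤
      Real.exp (2 ^ k * sCost d l0 θ k) * q ^ (Pat.cnt k t) := by
    intro t
    have h1 := Ev_bound r0 l0 L0 θ hl hL I (fun k => P (w / A k)) (fun k => Ax.prob _ (hwk k))
      (fun k => Real.exp (-(Ax.fP (LSc l0 L0 θ k)))) q hq0 hq1 herr
      (by
        intro x
        have : w / A 0 = w := by rw [hA, lvl_zero, div_one]
        change (P (w / A 0)).real _ ≤ q
        rw [this]
        exact hsB x)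
      (by
        intro k t₁ t₂ x₁ x₂ hx
        refine Ax.decoupleInc (rSc r0 θ k) (LSc l0 L0 θ k) (hRP k) (hLpos k) x₁ x₂ hx
          (w / A k) (w / A (k+1)) (hwk (k+1)) (hwk k)
          (div_lt_div_of_pos_left hw0 (hApos k) (hAlt k)) ?_ _ _
          (hIm k t₁ x₁) (hIm k t₂ x₂) (Ev_increasing r0 l0 L0 θ I hIinc k t₁ x₁)
          (Ev_increasing r0 l0 L0 θ I hIinc k t₂ x₂)
          (Ev_dependsOn r0 l0 L0 θ hl2 I hIdep k t₁ x₁)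
          (Ev_dependsOn r0 l0 L0 θ hl2 I hIdep k t₂ x₂)
        rw [hAs]
        apply le_of_eq
        have h3 := (hApos k).ne'
        have h4 : 1 + (rSc r0 θ k : ℝ) ^ (-Ax.χP) ≠ 0 := by linarith [hrp k]
        field_simp)
      k t 0
    refine le_trans ?_ h1
    have := Ax.prob _ (hwk k)
    exact ENNReal.toReal_mono (measure_ne_top _ _) (Ax.mono u hu (w / A k) (hwk k) (hwk1 k) _
      (hIm k t 0) (Ev_increasing r0 l0 L0 θ I hIinc k t 0))
  have hAsub : ∀ x, (eventA d η L0 x)ᶜ ⊆ D x ∪ I x := by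
    intro x ω hω
    by_contra hcon
    rw [Set.mem_union, not_or] at hcon
    exact hω (goodA_eventB_subset η hη L0 hL x ⟨not_not.1 hcon.1, not_not.1 hcon.2⟩)
  have hfA := pattern_sum (P u) r0 l0 L0 θ (fun x => (eventA d η L0 x)ᶜ) D I hAsub (S l0) k 0
    (hS k) hbD hbI
  have hfB := pattern_sum (P u) r0 l0 L0 θ (fun x => (eventB d η L0 x)ᶜ) D I
    (fun x => Set.subset_union_right) (S l0) k 0 (hS k) hbD hbI
  calc (P u (kBad d η r0 l0 L0 θ k (0 : Pt d))).toReal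
      ≤ (P u).real (Abar d η r0 l0 L0 θ k 0) + (P u).real (Bbar d η r0 l0 L0 θ k 0) :=
        measureReal_union_le _ _
    _ ≤ (2⁻¹ : ℝ) ^ (2 ^ k) + (2⁻¹ : ℝ) ^ (2 ^ k) := add_le_add hfA hfB
    _ = 2 * (2⁻¹ : ℝ) ^ (2 ^ k) := by ring

end Perco
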